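/- arXiv:2004.11304 — 3 statements merged into one kernel-verified Lean document; each statement's English description precedes it below -/
import Mathlib

section
/- Let 𝔤 be a finite-dimensional complex semisimple Lie algebra and let 𝔣 ≤ 𝔤 be a Lie subalgebra which is itself a semisimple Lie algebra. If 𝔥 is a Cartan subalgebra of 𝔣 whose dimension equals the rank of 𝔤 (i.e. 𝔣 has full rank in 𝔤), then 𝔥, regarded as a subalgebra of 𝔤, is a Cartan subalgebra of 𝔤. -/
open Module LieAlgebra LieSubalgebra

attribute [local instance 100] LieRing.ofAssociativeRing

lemma jc_aux {L : Type*} [LieRing L] [LieAlgebra ℂ L] [FiniteDimensional ℂ L]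
    [LieAlgebra.IsKilling ℂ L] (x : L) :
    ∃ n s : L, x = n + s ∧ IsNilpotent (ad ℂ L n) ∧ (ad ℂ L s).IsSemisimple ∧
      ad ℂ L n ∈ Algebra.adjoin ℂ {ad ℂ L x} ∧ ad ℂ L s ∈ Algebra.adjoin ℂ {ad ℂ L x} := by
  obtain ⟨N, hN₀, S, hS₀, hN, hS, hSN⟩ := (ad ℂ L x).exists_isNilpotent_isSemisimple
  have hSc : Commute (ad ℂ L x) S := Algebra.commute_of_mem_adjoin_self hS₀
  have hN' := hN
  rw [eq_sub_of_add_eq hSN.symm] at hN'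
  have aux {α : ℂ} {y : L} (hy : y ∈ (ad ℂ L x).maxGenEigenspace α) : S y = α • y := by
    rw [End.maxGenEigenspace_eq] at hy
    rw [End.apply_eq_of_mem_of_comm_of_isFinitelySemisimple_of_isNil hy hSc
      hS.isFinitelySemisimple hN']
  have h_der (y z : L) (α β : ℂ) (hy : y ∈ (ad ℂ L x).maxGenEigenspace α)
      (hz : z ∈ (ad ℂ L x).maxGenEigenspace β) :
      S ⁅y, z⁆ = ⁅S y, z⁆ + ⁅y, S z⁆ := by
    have hyz : ⁅y, z⁆ ∈ (ad ℂ L x).maxGenEigenspace (α + β) :=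
      LieModule.lie_mem_maxGenEigenspace_toEnd hy hz
    rw [aux hy, aux hz, aux hyz, smul_lie, lie_smul, ← add_smul]
  replace h_der (y z : L) : S ⁅y, z⁆ = ⁅S y, z⁆ + ⁅y, S z⁆ := by
    have hy : y ∈ ⨆ α : ℂ, (ad ℂ L x).maxGenEigenspace α := by
      simp [End.iSup_maxGenEigenspace_eq_top]
    have hz : z ∈ ⨆ α : ℂ, (ad ℂ L x).maxGenEigenspace α := by
      simp [End.iSup_maxGenEigenspace_eq_top]
    induction hy using Submodule.iSup_induction' with
    | mem α y hy =>
      induction hz using Submodule.iSup_induction' with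
      | mem β z hz => exact h_der y z α β hy hz
      | zero => simp
      | add _ _ _ _ h h' => simp only [lie_add, map_add, h, h']; abel
    | zero => simp
    | add _ _ _ _ h h' => simp only [add_lie, map_add, h, h']; abel
  replace h_der : ∀ y z : L, S ⁅y, z⁆ = ⁅y, S z⁆ - ⁅z, S y⁆ := by
    simp_rw [← lie_skew (S _) _, add_comm, ← sub_eq_add_neg] at h_der; assumption
  let S' : LieDerivation ℂ L L := ⟨S, h_der⟩
  obtain ⟨s, hs⟩ := LieDerivation.IsKilling.exists_eq_ad S'
  have hs' : ad ℂ L s = S := by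
    ext z
    have := DFunLike.congr_fun hs z
    rw [LieDerivation.ad_apply_apply] at this
    exact this
  have hn' : ad ℂ L (x - s) = N := by rw [map_sub, hs', hSN]; abel
  exact ⟨x - s, s, by abel, hn' ▸ hN, hs' ▸ hS, hn' ▸ hN₀, hs' ▸ hS₀⟩

lemma exists_engel_eq {L : Type*} [LieRing L] [LieAlgebra ℂ L] [FiniteDimensional ℂ L]
    (H : LieSubalgebra ℂ L) [H.IsCartanSubalgebra] :
    ∃ x ∈ H, engel ℂ x = H := by
  have hle : ∀ y ∈ H, H ≤ engel ℂ y := by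
    intro y hy z hz
    have := le_zeroRootSubalgebra ℂ L H hz
    rw [mem_zeroRootSubalgebra] at this
    obtain ⟨k, hk⟩ := this ⟨y, hy⟩
    rw [mem_engel_iff]
    exact ⟨k, hk⟩
  have hne : {n | ∃ x ∈ H, finrank ℂ (engel ℂ x) = n}.Nonempty := ⟨_, 0, H.zero_mem, rfl⟩
  obtain ⟨x, hx, hxn⟩ := Nat.sInf_mem hne
  refine ⟨x, hx, le_antisymm ?_ (hle x hx)⟩
  let E : {engel ℂ x | x ∈ H} := ⟨engel ℂ x, x, hx, rfl⟩
  have hbot : IsBot E := by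
    apply engel_isBot_of_isMin _ H E (hle x hx)
    · rintro ⟨_, y, hy, rfl⟩ hyx
      suffices engel ℂ y = engel ℂ x from this.ge
      apply LieSubalgebra.toSubmodule_injective
      refine Submodule.eq_of_le_of_finrank_le hyx ?_
      change finrank ℂ (engel ℂ x) ≤ finrank ℂ (engel ℂ y)
      rw [hxn]
      exact Nat.sInf_le ⟨y, hy, rfl⟩
    · exact Cardinal.natCast_le_aleph0.trans <| Cardinal.infinite_iff.mp inferInstance
  intro z hz
  rw [← zeroRootSubalgebra_eq_of_is_cartan ℂ L H, mem_zeroRootSubalgebra]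
  rintro ⟨y, hy⟩
  have : z ∈ engel ℂ y := (hbot ⟨engel ℂ y, y, hy, rfl⟩) hz
  rw [mem_engel_iff] at this
  exact this

lemma sup_range_ad {L : Type*} [LieRing L] [LieAlgebra ℂ L] [FiniteDimensional ℂ L]
    (x y : L) : ∃ h ∈ engel ℂ x, ∃ z : L, h + ⁅z, x⁆ = y := by
  obtain ⟨n, hn⟩ := (Filter.eventually_atTop.mp (ad ℂ L x).eventually_codisjoint_ker_pow_range_pow)
  have h1 := codisjoint_iff.mp (hn (n+1) (by omega))
  have : y ∈ LinearMap.ker (ad ℂ L x ^ (n+1)) ⊔ LinearMap.range (ad ℂ L x ^ (n+1)) := by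
    rw [h1]; trivial
  obtain ⟨h, hh, z, ⟨w, rfl⟩, rfl⟩ := Submodule.mem_sup.mp this
  refine ⟨h, (mem_engel_iff _ _ _).2 ⟨n+1, hh⟩, -((ad ℂ L x ^ n) w), ?_⟩
  rw [neg_lie, lie_skew, pow_succ', Module.End.mul_apply, ad_apply]

lemma exists_small_regular {L : Type*} [LieRing L] [LieAlgebra ℂ L] [FiniteDimensional ℂ L]
    (x : L) : ∃ y : L, ∃ s : Set ℂ, s.Finite ∧ ∀ t ∉ s, IsRegular ℂ (x + t • y) := by
  obtain ⟨y0, hy0⟩ := exists_isRegular ℂ L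
  classical
  let b := Module.Free.chooseBasis ℂ L
  let P := (LinearMap.polyCharpoly (ad ℂ L).toLinearMap b).coeff (rank ℂ L)
  let Q : Polynomial ℂ := MvPolynomial.aeval
    (fun i ↦ Polynomial.C (b.repr (y0 - x) i) * Polynomial.X + Polynomial.C (b.repr x i)) P
  have key : ∀ t : ℂ, Q.eval t = MvPolynomial.eval (b.repr (x + t • (y0 - x))) P := by
    intro t
    have aux : (fun i ↦ (b.repr (y0 - x)) i * t + (b.repr x) i) = b.repr (x + t • (y0 - x)) := by
      ext i; simp [mul_comm t, add_comm]
    rw [← aux]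
    simp only [Q]
    rw [← Polynomial.coe_aeval_eq_eval, ← AlgHom.comp_apply, MvPolynomial.comp_aeval,
      MvPolynomial.aeval_eq_eval]
    simp
  have hQ : Q ≠ 0 := by
    intro h
    have := key 1
    rw [isRegular_iff_coeff_polyCharpoly_rank_ne_zero ℂ b] at hy0
    apply hy0
    rw [h] at this
    have h2 := this.symm
    rw [one_smul, add_sub_cancel] at h2
    exact h2.trans (by simp)
  refine ⟨y0 - x, {t | Q.IsRoot t}, Polynomial.finite_setOfPred_isRoot hQ, ?_⟩
  intro t ht
  rw [isRegular_iff_coeff_polyCharpoly_rank_ne_zero ℂ b]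
  rw [← key]; exact ht

lemma exp_lie {L : Type*} [NormedAddCommGroup L] [NormedSpace ℂ L] [CompleteSpace L]
    (B : L →L[ℂ] L →L[ℂ] L) (D : L →L[ℂ] L) (hD : ∀ a b, D (B a b) = B (D a) b + B a (D b))
    (a b : L) : NormedSpace.exp D (B a b) = B (NormedSpace.exp D a) (NormedSpace.exp D b) := by
  let : NormedAlgebra ℚ (L →L[ℂ] L) := NormedAlgebra.restrictScalars ℚ ℂ _
  let g : ℂ → L := fun t ↦ NormedSpace.exp (t • (-D)) (B (NormedSpace.exp (t • D) a) (NormedSpace.exp (t • D) b))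
  have h1 : ∀ (D : L →L[ℂ] L) (a : L) (t : ℂ), HasDerivAt (fun t : ℂ ↦ NormedSpace.exp (t • D) a)
      (D (NormedSpace.exp (t • D) a)) t := by
    intro D a t
    have := (hasDerivAt_exp_smul_const' (𝕂 := ℂ) D t)
    exact this.clm_apply (hasDerivAt_const t a) |>.congr_deriv (by simp)
  have hg : ∀ t, HasDerivAt g 0 t := by
    intro t
    have h2 := hasDerivAt_exp_smul_const (𝕂 := ℂ) (-D) t
    have h3 : HasDerivAt (fun t : ℂ ↦ B (NormedSpace.exp (t • D) a)) (B (D (NormedSpace.exp (t • D) a))) t :=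
      B.hasFDerivAt.comp_hasDerivAt t (h1 D a t)
    have h4 := h2.clm_apply (h3.clm_apply (h1 D b t))
    refine h4.congr_deriv ?_
    simp [hD]
  have h5 := is_const_of_deriv_eq_zero (fun t ↦ (hg t).differentiableAt) (fun t ↦ (hg t).deriv) 1 0
  simp only [g, one_smul, zero_smul, NormedSpace.exp_zero, one_apply_eq_self] at h5
  rw [← h5, ← mul_apply_eq_comp, ← NormedSpace.exp_add_of_commute]
  · simp
  · exact (Commute.refl D).neg_right

open Topology in
lemma nhd_aux {E : Type*} [NormedAddCommGroup E] [NormedSpace ℂ E] [FiniteDimensional ℂ E]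
    (B : E →L[ℂ] E →L[ℂ] E) (hB : ∀ z a b, B z (B a b) = B (B z a) b + B a (B z b))
    (H : Submodule ℂ E) (hH : ∀ a ∈ H, ∀ b ∈ H, B a b = 0) (x : E) (hx : x ∈ H)
    (hs : ∀ y, ∃ h ∈ H, ∃ z, h + B z x = y) (y : E) :
    ∀ᶠ t in 𝓝 (0 : ℂ), finrank ℂ H ≤ finrank ℂ (LinearMap.ker (B (x + t • y)).toLinearMap) := by
  have : CompleteSpace E := FiniteDimensional.complete ℂ E
  have : CompleteSpace H := FiniteDimensional.complete ℂ H
  let : NormedAlgebra ℚ (E →L[ℂ] E) := NormedAlgebra.restrictScalars ℚ ℂ _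
  let Φ : H × E → E := fun p ↦ NormedSpace.exp (B p.2) (p.1 : E)
  let p0 : H × E := (⟨x, hx⟩, 0)
  have hfst : HasStrictFDerivAt (fun p : H × E ↦ (p.1 : E))
      (H.subtypeL.comp (ContinuousLinearMap.fst ℂ H E)) p0 :=
    (H.subtypeL.comp (ContinuousLinearMap.fst ℂ H E)).hasStrictFDerivAt
  have hsnd : HasStrictFDerivAt (fun p : H × E ↦ B p.2)
      (B.comp (ContinuousLinearMap.snd ℂ H E)) p0 :=
    (B.comp (ContinuousLinearMap.snd ℂ H E)).hasStrictFDerivAt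
  have hexp : HasStrictFDerivAt (NormedSpace.exp : (E →L[ℂ] E) → (E →L[ℂ] E))
      (1 : (E →L[ℂ] E) →L[ℂ] (E →L[ℂ] E)) (B p0.2) := by
    have : B p0.2 = 0 := by simp [p0]
    rw [this]
    exact hasStrictFDerivAt_exp_zero
  have hΦ := (hexp.comp p0 hsnd).clm_apply hfst
  have hmap := hΦ.map_nhds_eq_of_surj (by
    rw [LinearMap.range_eq_top]
    intro y
    obtain ⟨h, hh, z, rfl⟩ := hs y
    refine ⟨(⟨h, hh⟩, z), ?_⟩
    simp [p0])
  have h0 : (NormedSpace.exp (B p0.2)) (p0.1 : E) = x := by simp [p0]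
  have hev : ∀ᶠ w in 𝓝 x, finrank ℂ H ≤ finrank ℂ (LinearMap.ker (B w).toLinearMap) := by
    have : ∀ᶠ w in Filter.map Φ (𝓝 p0),
        finrank ℂ H ≤ finrank ℂ (LinearMap.ker (B w).toLinearMap) := by
      rw [Filter.eventually_map]
      refine Filter.Eventually.of_forall fun p ↦ ?_
      have hinj : Function.Injective (NormedSpace.exp (B p.2)).toLinearMap := by
        intro a b hab
        have h1 : ∀ a, NormedSpace.exp (-(B p.2)) (NormedSpace.exp (B p.2) a) = a := by
          intro a
          rw [← mul_apply_eq_comp, ← NormedSpace.exp_add_of_commute (Commute.refl (B p.2)).neg_left]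
          simp
        change NormedSpace.exp (B p.2) a = NormedSpace.exp (B p.2) b at hab
        rw [← h1 a, hab, h1]
      have hle : H.map (NormedSpace.exp (B p.2)).toLinearMap ≤
          LinearMap.ker (B (Φ p)).toLinearMap := by
        rintro _ ⟨a, ha, rfl⟩
        change B (NormedSpace.exp (B p.2) (p.1 : E)) (NormedSpace.exp (B p.2) a) = 0
        rw [← exp_lie B (B p.2) (hB p.2), hH _ p.1.2 _ ha, map_zero]
      rw [(Submodule.equivMapOfInjective _ hinj H).finrank_eq]
      exact Submodule.finrank_mono hle
    change ∀ᶠ w in Filter.map (fun p : H × E ↦ NormedSpace.exp (B p.2) (p.1 : E)) (𝓝 p0), _ at this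
    have hm2 : Filter.map (fun p : H × E ↦ NormedSpace.exp (B p.2) (p.1 : E)) (𝓝 p0) = 𝓝 x := by
      rw [← h0]; exact hmap
    rwa [hm2] at this
  have hc : Filter.Tendsto (fun t : ℂ ↦ x + t • y) (𝓝 0) (𝓝 x) := by
    have : Continuous (fun t : ℂ ↦ x + t • y) := by fun_prop
    simpa using this.tendsto 0
  exact hc.eventually hev

open Topology in
lemma nhd_lie {L : Type*} [LieRing L] [LieAlgebra ℂ L] [FiniteDimensional ℂ L]
    (H : LieSubalgebra ℂ L) (hH : ∀ a ∈ H, ∀ b ∈ H, ⁅a, b⁆ = 0) (x : L) (hx : x ∈ H)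
    (hs : ∀ y : L, ∃ h ∈ H, ∃ z : L, h + ⁅z, x⁆ = y) (y : L) :
    ∀ᶠ t in 𝓝 (0 : ℂ), finrank ℂ H ≤ finrank ℂ (LinearMap.ker (ad ℂ L (x + t • y))) := by
  let e := (Module.finBasis ℂ L).equivFun
  let i1 : NormedAddCommGroup L := NormedAddCommGroup.induced L _ e e.injective
  let i2 : NormedSpace ℂ L := NormedSpace.induced ℂ L _ e
  let B : L →L[ℂ] L →L[ℂ] L := LinearMap.toContinuousLinearMap
    ((LinearMap.toContinuousLinearMap (𝕜 := ℂ) (E := L) (F' := L)).toLinearMap ∘ₗ (ad ℂ L).toLinearMap)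
  have hBa : ∀ a b, B a b = ⁅a, b⁆ := fun a b ↦ rfl
  exact nhd_aux B (by intro z a b; simp only [hBa]; exact leibniz_lie z a b) H.toSubmodule hH x hx hs y

lemma finrank_cartan {L : Type*} [LieRing L] [LieAlgebra ℂ L] [FiniteDimensional ℂ L]
    [LieAlgebra.IsKilling ℂ L] (H : LieSubalgebra ℂ L) [H.IsCartanSubalgebra] :
    finrank ℂ H = rank ℂ L := by
  obtain ⟨x, hx, hxe⟩ := exists_engel_eq H
  apply le_antisymm
  · obtain ⟨y, s, hsf, hreg⟩ := exists_small_regular x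
    have hab : ∀ a ∈ H, ∀ b ∈ H, ⁅a, b⁆ = 0 := by
      intro a ha b hb
      have := trivial_lie_zero H H ⟨a, ha⟩ ⟨b, hb⟩
      simpa using congrArg Subtype.val this
    have h1 := nhd_lie H hab x hx (by
      intro y
      have := sup_range_ad x y
      rwa [hxe] at this) y
    have h2 := h1.filter_mono (nhdsWithin_le_nhds (s := {0}ᶜ))
    have h3 : ∀ᶠ t in nhdsWithin (0 : ℂ) {0}ᶜ, t ∉ s := by
      have : (s \ {0})ᶜ ∈ nhds (0 : ℂ) := (hsf.subset Set.sdiff_subset).isClosed.isOpen_compl.mem_nhds (by simp)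
      filter_upwards [mem_nhdsWithin_of_mem_nhds this, self_mem_nhdsWithin] with t ht ht0 hts
      exact ht ⟨hts, ht0⟩
    obtain ⟨t, ht, hts⟩ := (h2.and h3).exists
    rw [← (isRegular_iff_finrank_engel_eq_rank ℂ _).mp (hreg t hts)]
    refine ht.trans (Submodule.finrank_mono (t := (engel ℂ (x + t • y)).toSubmodule) ?_)
    intro z hz
    change z ∈ engel ℂ (x + t • y)
    rw [mem_engel_iff]
    exact ⟨1, by simpa using hz⟩
  · rw [← hxe]
    exact rank_le_finrank_engel ℂ x

lemma toral_cartan {L : Type*} [LieRing L] [LieAlgebra ℂ L] [FiniteDimensional ℂ L]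
    (S : Set L) (hc : ∀ a ∈ S, ∀ b ∈ S, ⁅a, b⁆ = 0) (hss : ∀ a ∈ S, (ad ℂ L a).IsSemisimple) :
    ∃ T : LieSubalgebra ℂ L, T.IsCartanSubalgebra ∧ S ⊆ T := by
  let M : LieSubalgebra ℂ L :=
    { carrier := {y | ∀ a ∈ S, ⁅a, y⁆ = 0}
      add_mem' := fun {y z} hy hz a ha ↦ by rw [lie_add, hy a ha, hz a ha, add_zero]
      zero_mem' := fun a _ ↦ lie_zero a
      smul_mem' := fun c y hy a ha ↦ by rw [lie_smul, hy a ha, smul_zero]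
      lie_mem' := fun {y z} hy hz a ha ↦ by
        rw [leibniz_lie, hy a ha, hz a ha, zero_lie, lie_zero, add_zero] }
  have hM : ∀ y, y ∈ M ↔ ∀ a ∈ S, ⁅a, y⁆ = 0 := fun y ↦ Iff.rfl
  obtain ⟨x, hx⟩ := exists_isCartanSubalgebra_engel ℂ M
  set T0 := engel ℂ x
  have hST0 : ∀ a (ha : a ∈ S), (⟨a, (hM a).2 fun b hb ↦ hc b hb a ha⟩ : M) ∈ T0 := by
    intro a ha
    rw [mem_engel_iff]
    refine ⟨1, ?_⟩
    rw [pow_one, ad_apply, ← lie_skew, neg_eq_zero]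
    apply Subtype.ext
    exact (hM x).1 x.2 a ha
  have hST : S ⊆ T0.map M.incl := by
    intro a ha
    exact ⟨_, hST0 a ha, rfl⟩
  refine ⟨T0.map M.incl, ⟨?_, ?_⟩, hST⟩
  · have := hx.nilpotent
    let φ : T0 →ₗ⁅ℂ⁆ (T0.map M.incl) :=
      { toFun := fun y ↦ ⟨M.incl y, y, y.2, rfl⟩
        map_add' := fun _ _ ↦ rfl
        map_smul' := fun _ _ ↦ rfl
        map_lie' := fun {_ _} ↦ rfl }
    have hφ : Function.Surjective φ := by
      rintro ⟨_, y, hy, rfl⟩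
      exact ⟨⟨y, hy⟩, rfl⟩
    exact hφ.lieAlgebra_isNilpotent
  · refine le_antisymm ?_ (le_normalizer _)
    intro y hy
    rw [mem_normalizer_iff] at hy
    have hyM : y ∈ M := by
      intro a ha
      have h1 : ⁅a, y⁆ ∈ T0.map M.incl := by
        rw [← lie_skew]; exact neg_mem (hy a (hST ha))
      have h2 : ⁅a, ⁅a, y⁆⁆ = 0 := by
        obtain ⟨w, -, hw⟩ := h1
        have := (hM _).1 w.2 a ha
        rw [← hw]; exact this
      have h3 : y ∈ (ad ℂ L a).maxGenEigenspace 0 := by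
        rw [End.mem_maxGenEigenspace]
        exact ⟨2, by simpa [pow_two] using h2⟩
      rw [(hss a ha).isFinitelySemisimple.maxGenEigenspace_eq_eigenspace,
        Module.End.mem_eigenspace_iff] at h3
      simpa using h3
    have : (⟨y, hyM⟩ : M) ∈ T0.normalizer := by
      rw [mem_normalizer_iff]
      intro w hw
      obtain ⟨v, hv, hv'⟩ := hy w ⟨w, hw, rfl⟩
      have : v = ⁅(⟨y, hyM⟩ : M), w⁆ := Subtype.ext hv'
      rw [← this]; exact hv
    rw [hx.self_normalizing] at this
    exact ⟨_, this, rfl⟩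

lemma jc_sub {L : Type*} [LieRing L] [LieAlgebra ℂ L] [FiniteDimensional ℂ L]
    (F : LieSubalgebra ℂ L) (h : F) (hh : (ad ℂ F h).IsSemisimple) (n s : L)
    (hns : (h : L) = n + s) (hn : IsNilpotent (ad ℂ L n)) (hs : (ad ℂ L s).IsSemisimple)
    (hna : ad ℂ L n ∈ Algebra.adjoin ℂ {ad ℂ L (h : L)})
    (hsa : ad ℂ L s ∈ Algebra.adjoin ℂ {ad ℂ L (h : L)}) :
    ∀ y ∈ F, ⁅n, y⁆ = 0 := by
  have inv : ∀ f ∈ Algebra.adjoin ℂ {ad ℂ L (h : L)}, ∀ y ∈ F.toSubmodule, f y ∈ F.toSubmodule := by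
    intro f hf
    induction hf using Algebra.adjoin_induction with
    | mem f hf =>
      rw [Set.mem_singleton_iff] at hf
      subst hf
      intro y hy
      exact F.lie_mem h.2 hy
    | algebraMap r => intro y hy; exact F.smul_mem r hy
    | add f g _ _ hf hg => intro y hy; exact F.add_mem (hf y hy) (hg y hy)
    | mul f g _ _ hf hg => intro y hy; exact hf _ (hg y hy)
  let nF : Module.End ℂ F := (ad ℂ L n).restrict (inv _ hna)
  let sF : Module.End ℂ F := (ad ℂ L s).restrict (inv _ hsa)
  have hnF : IsNilpotent nF := Module.End.isNilpotent.restrict _ hn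
  have hsF : sF.IsSemisimple := Module.End.IsSemisimple.restrict (inv _ hsa) hs
  have hcom : Commute (ad ℂ L n) (ad ℂ L s) :=
    Algebra.commute_of_mem_adjoin_singleton_of_commute hsa
      (Algebra.commute_of_mem_adjoin_self hna).symm
  have hcF : Commute nF sF := by
    ext y
    exact LinearMap.congr_fun hcom y
  have hsum : nF + sF = 0 + ad ℂ F h := by
    ext y
    change ⁅n, (y : L)⁆ + ⁅s, (y : L)⁆ = 0 + ⁅(h : L), (y : L)⁆
    rw [hns, add_lie, zero_add]
  have := (Module.End.isNilpotent_isSemisimple_unique hnF hsF IsNilpotent.zero hh hcF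
    (Commute.zero_left _) hsum).1
  intro y hy
  exact congrArg Subtype.val (LinearMap.congr_fun this ⟨y, hy⟩)

theorem cartan_subalgebra_of_full_rank_semisimple_subalgebra
    {L : Type*} [LieRing L] [LieAlgebra ℂ L] [FiniteDimensional ℂ L]
    [LieAlgebra.IsSemisimple ℂ L]
    (F : LieSubalgebra ℂ L) [LieAlgebra.IsSemisimple ℂ F]
    (H : LieSubalgebra ℂ F) (hH : H.IsCartanSubalgebra)
    (hrank : ∃ H' : LieSubalgebra ℂ L, H'.IsCartanSubalgebra ∧
        Module.finrank ℂ H = Module.finrank ℂ H') :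
    (H.map F.incl).IsCartanSubalgebra := by
  obtain ⟨H', hH', hrk⟩ := hrank
  rw [finrank_cartan H'] at hrk
  choose n s hns hn hs hna hsa using fun x : L ↦ jc_aux x
  have hab : ∀ a ∈ H, ∀ b ∈ H, ⁅a, b⁆ = 0 := by
    intro a ha b hb
    have := trivial_lie_zero H H ⟨a, ha⟩ ⟨b, hb⟩
    simpa using congrArg Subtype.val this
  have hnF : ∀ h ∈ H, ∀ y ∈ F, ⁅n h, y⁆ = 0 := fun h hh ↦
    jc_sub F h (IsKilling.isSemisimple_ad_of_mem_isCartanSubalgebra (H := H) hh) _ _ (hns h) (hn h) (hs h)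
      (hna h) (hsa h)
  have hcomm : ∀ a ∈ H, ∀ b ∈ H, Commute (ad ℂ L (a : L)) (ad ℂ L (b : L)) := by
    intro a ha b hb
    have h1 : ⁅(a : L), (b : L)⁆ = 0 := congrArg Subtype.val (hab a ha b hb)
    have : ⁅ad ℂ L (a : L), ad ℂ L (b : L)⁆ = 0 := by rw [← LieHom.map_lie, h1, map_zero]
    rwa [Commute, SemiconjBy, ← sub_eq_zero, ← Ring.lie_def]
  have hzero : ∀ a b : L, Commute (ad ℂ L a) (ad ℂ L b) → ⁅a, b⁆ = 0 := by
    intro a b h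
    rw [← LieDerivation.IsKilling.ad_apply_eq_zero_iff ℂ L]
    ext z
    have := LinearMap.congr_fun h z
    simp only [Module.End.mul_apply, ad_apply] at this
    rw [LieDerivation.ad_apply_apply, lie_lie, this, sub_self, LieDerivation.zero_apply]
  have hpoly : ∀ a ∈ H, ∀ b ∈ H, ∀ f ∈ Algebra.adjoin ℂ {ad ℂ L (a : L)},
      ∀ g ∈ Algebra.adjoin ℂ {ad ℂ L (b : L)}, Commute f g := by
    intro a ha b hb f hf g hg
    have h1 : Commute (ad ℂ L (a : L)) g :=
      Algebra.commute_of_mem_adjoin_singleton_of_commute hg (hcomm a ha b hb)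
    exact (Algebra.commute_of_mem_adjoin_singleton_of_commute hf h1.symm).symm
  let S : Set L := {z | ∃ h ∈ H, z = s (h : F)}
  obtain ⟨T, hT, hST⟩ := toral_cartan S
    (by
      rintro _ ⟨a, ha, rfl⟩ _ ⟨b, hb, rfl⟩
      exact hzero _ _ (hpoly a ha b hb _ (hsa _) _ (hsa _)))
    (by
      rintro _ ⟨a, ha, rfl⟩
      exact hs _)
  -- the centralizer of F
  let C : Submodule ℂ L :=
    { carrier := {c | ∀ y ∈ F, ⁅c, y⁆ = 0}
      add_mem' := fun {a b} ha hb y hy ↦ by rw [add_lie, ha y hy, hb y hy, add_zero]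
      zero_mem' := fun y _ ↦ zero_lie y
      smul_mem' := fun c a ha y hy ↦ by rw [smul_lie, ha y hy, smul_zero] }
  let HL : LieSubalgebra ℂ L := H.map F.incl
  have hHLrk : finrank ℂ HL = rank ℂ L := by
    rw [← hrk]
    exact ((Submodule.equivMapOfInjective (F.incl : F →ₗ[ℂ] L) Subtype.val_injective
      H.toSubmodule).finrank_eq).symm
  have hdisj : ∀ z ∈ HL, z ∈ C → z = 0 := by
    rintro _ ⟨h, hh, rfl⟩ hz
    have : LieDerivation.ad ℂ F h = 0 := by
      ext y
      rw [LieDerivation.ad_apply_apply]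
      exact hz y y.2
    rw [LieDerivation.IsKilling.ad_apply_eq_zero_iff ℂ F] at this
    rw [this]; rfl
  have hle : finrank ℂ HL ≤ finrank ℂ (Submodule.span ℂ S) := by
    let q : HL →ₗ[ℂ] L ⧸ C := C.mkQ ∘ₗ HL.toSubmodule.subtype
    have hq : Function.Injective q := by
      rw [← LinearMap.ker_eq_bot, LinearMap.ker_eq_bot']
      intro z hz
      apply Subtype.ext
      exact hdisj z z.2 ((Submodule.Quotient.mk_eq_zero C).1 hz)
    have hr : LinearMap.range q ≤ (Submodule.span ℂ S).map C.mkQ := by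
      rintro _ ⟨⟨_, h, hh, rfl⟩, rfl⟩
      refine ⟨s h, Submodule.subset_span ⟨h, hh, rfl⟩, ?_⟩
      change C.mkQ (s h) = C.mkQ (h : L)
      have h0 : C.mkQ (n h) = 0 := (Submodule.Quotient.mk_eq_zero C).2 (hnF h hh)
      conv_rhs => rw [hns h, map_add, h0, zero_add]
    calc finrank ℂ HL = finrank ℂ (LinearMap.range q) := (LinearMap.finrank_range_of_inj hq).symm
      _ ≤ _ := Submodule.finrank_mono hr
      _ ≤ _ := Submodule.finrank_map_le _ _
  have hspan : Submodule.span ℂ S = T.toSubmodule := by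
    refine Submodule.eq_of_le_of_finrank_le (Submodule.span_le.2 hST) ?_
    change finrank ℂ T ≤ _
    rw [finrank_cartan T, ← hHLrk]
    exact hle
  have hn0 : ∀ h ∈ H, n (h : F) = 0 := by
    intro h hh
    have hcen : ∀ y ∈ Submodule.span ℂ S, ⁅n (h : L), y⁆ = 0 := by
      intro y hy
      induction hy using Submodule.span_induction with
      | mem y hy =>
        obtain ⟨a, ha, rfl⟩ := hy
        exact hzero _ _ (hpoly h hh a ha _ (hna _) _ (hsa _))
      | zero => simp
      | add y z _ _ hy hz => rw [lie_add, hy, hz, add_zero]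
      | smul c y _ hy => rw [lie_smul, hy, smul_zero]
    have hnT : n (h : L) ∈ T := by
      rw [← hT.self_normalizing, mem_normalizer_iff]
      intro y hy
      have hy' : y ∈ Submodule.span ℂ S := by rw [hspan]; exact hy
      rw [hcen y hy']
      exact T.zero_mem
    exact IsKilling.eq_zero_of_isNilpotent_ad_of_mem_isCartanSubalgebra ℂ L T hnT (hn _)
  have hHT : HL = T := by
    apply LieSubalgebra.toSubmodule_injective
    refine Submodule.eq_of_le_of_finrank_le ?_ ?_
    · rintro _ ⟨h, hh, rfl⟩
      have h1 := hns (h : L)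
      rw [hn0 h hh, zero_add] at h1
      change (h : L) ∈ T
      rw [h1]
      exact hST ⟨h, hh, rfl⟩
    · change finrank ℂ T ≤ finrank ℂ HL
      rw [finrank_cartan T, hHLrk]
  change HL.IsCartanSubalgebra
  rw [hHT]; exact hT
end

section
/- Let 𝔣 be a semisimple Lie subalgebra of a finite-dimensional complex semisimple Lie algebra 𝔤 such that the rank of 𝔣 equals the rank of 𝔤. Then 𝔣 is regular in 𝔤: there exists a Cartan subalgebra 𝔥 of 𝔤 such that, as subspaces of 𝔤, 𝔣 = (𝔥 ∩ 𝔣) ⊕ ⨁_{α ∈ Φ} (𝔤_α ∩ 𝔣), where Φ is the set of roots of (𝔤, 𝔥) and 𝔤_α is the root space of α. -/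
/-- For a subalgebra `H` of a Lie algebra `L` and a linear functional `α` on `H`, the
simultaneous eigenspace `{x ∈ L | ∀ h ∈ H, ⁅h, x⁆ = α h • x}`; for a Cartan subalgebra of a
complex semisimple Lie algebra this is the root space of `α` (for `α ≠ 0`). -/
def simRootSpace {L : Type*} [LieRing L] [LieAlgebra ℂ L] (H : LieSubalgebra ℂ L)
    (α : H →ₗ[ℂ] ℂ) : Submodule ℂ L where
  carrier := {x | ∀ h : H, ⁅(h : L), x⁆ = α h • x}
  add_mem' := fun ha hb h => by rw [lie_add, ha h, hb h, smul_add]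
  zero_mem' := fun h => by rw [lie_zero, smul_zero]
  smul_mem' := fun c x hx h => by rw [lie_smul, hx h, smul_comm]

section helpers
open Module


theorem isSemisimple_of_iSup_eigenspace {V : Type*} [AddCommGroup V] [Module ℂ V]
    [FiniteDimensional ℂ V] (h : End ℂ V) (H : ⨆ μ, h.eigenspace μ = ⊤) : h.IsSemisimple := by
  classical
  have hfin : Set.Finite {μ | h.HasEigenvalue μ} := Module.End.finite_hasEigenvalue h
  let S := hfin.toFinset
  refine Module.End.isSemisimple_of_squarefree_aeval_eq_zero
    (p := ∏ μ ∈ S, (Polynomial.X - Polynomial.C μ)) ?_ ?_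
  · exact (Polynomial.separable_prod_X_sub_C_iff'.mpr (fun x _ y _ hxy => hxy)).squarefree
  · rw [← LinearMap.ker_eq_top, eq_top_iff, ← H]
    refine iSup_le fun μ v hv => ?_
    by_cases hv0 : v = 0
    · simp [hv0]
    have hμ : μ ∈ S := by
      simp only [S, Set.Finite.mem_toFinset, Set.mem_ofPred_eq]
      exact Module.End.hasEigenvalue_of_hasEigenvector ⟨hv, hv0⟩
    have := Module.End.aeval_apply_of_hasEigenvector (f := h) (p := ∏ μ ∈ S, (Polynomial.X - Polynomial.C μ)) ⟨hv, hv0⟩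
    rw [LinearMap.mem_ker, this, Polynomial.eval_prod, Finset.prod_eq_zero hμ (by simp), zero_smul]

theorem map_gen {V : Type*} [AddCommGroup V] [Module ℂ V]
    (h e : End ℂ V) (c : ℂ) (he : h * e - e * h = c • e) (μ : ℂ) (v : V)
    (hv : v ∈ h.maxGenEigenspace μ) : e v ∈ h.maxGenEigenspace (μ + c) := by
  rw [Module.End.mem_maxGenEigenspace] at hv ⊢
  obtain ⟨k, hk⟩ := hv
  refine ⟨k, ?_⟩
  have h1 : (h - (μ + c) • 1) * e = e * (h - μ • 1) := by
    have : h * e = c • e + e * h := by rw [← he]; abel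
    rw [sub_mul, mul_sub, this, add_smul]
    simp only [add_mul, smul_mul_assoc, one_mul, mul_smul_comm, mul_one]
    abel
  have h2 : SemiconjBy e (h - μ • 1) (h - (μ + c) • 1) := h1.symm
  have h3 := h2.pow_right k
  have := congrArg (fun g => g v) h3.eq
  simp only [Module.End.mul_apply] at this
  rw [← this, hk, map_zero]

theorem pow_gen {V : Type*} [AddCommGroup V] [Module ℂ V]
    (h e : End ℂ V) (c : ℂ) (he : h * e - e * h = c • e) (μ : ℂ) (v : V)
    (hv : v ∈ h.maxGenEigenspace μ) (n : ℕ) : (e ^ n) v ∈ h.maxGenEigenspace (μ + n * c) := by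
  induction n with
  | zero => simpa using hv
  | succ n ih =>
    rw [pow_succ', Module.End.mul_apply]
    have := map_gen h e c he _ _ ih
    convert this using 2
    push_cast; ring

theorem exists_pow_zero {V : Type*} [AddCommGroup V] [Module ℂ V] [FiniteDimensional ℂ V]
    (h e : End ℂ V) (c : ℂ) (hc : c ≠ 0) (he : h * e - e * h = c • e) (μ : ℂ) (v : V)
    (hv : v ∈ h.maxGenEigenspace μ) : ∃ n : ℕ, (e ^ n) v = 0 := by
  by_contra! H
  have hfin : Set.Finite {μ | h.HasEigenvalue μ} := Module.End.finite_hasEigenvalue h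
  have : Set.range (fun n : ℕ => μ + n * c) ⊆ {μ | h.HasEigenvalue μ} := by
    rintro _ ⟨n, rfl⟩
    have h1 := pow_gen h e c he μ v hv n
    rw [Set.mem_ofPred_eq]
    by_contra h2
    have h3 : h.maxGenEigenspace (μ + n * c) = ⊥ := by
      by_contra h4
      apply h2
      rw [Module.End.mem_maxGenEigenspace] at h1
      obtain ⟨k, hk⟩ := h1
      refine Module.End.hasEigenvalue_of_hasGenEigenvalue (k := k) ?_
      rw [Module.End.hasGenEigenvalue_iff]
      intro h5
      apply H n
      have : (e ^ n) v ∈ h.genEigenspace (μ + n * c) k := by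
        rw [Module.End.mem_genEigenspace_nat]; exact hk
      rw [h5] at this
      simpa using this
    rw [h3] at h1
    exact H n (by simpa using h1)
  refine Set.infinite_range_of_injective ?_ (hfin.subset this)
  intro a b hab
  simpa [hc] using hab

theorem ef_formula {V : Type*} [AddCommGroup V] [Module ℂ V]
    (h e f : End ℂ V) (hf : h * f - f * h = (-2 : ℂ) • f)
    (hef : e * f - f * e = h) (n : ℕ) :
    e * f ^ (n + 1) = f ^ (n + 1) * e + ((n : ℂ) + 1) • (f ^ n * (h - (n : ℂ) • 1)) := by
  have h1 : e * f = f * e + h := by rw [← hef]; abel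
  have h2 : h * f = f * h - (2 : ℂ) • f := by
    have : h * f = f * h + (-2 : ℂ) • f := by rw [← hf]; abel
    rw [this, neg_smul, sub_eq_add_neg]
  induction n with
  | zero => simp [h1]
  | succ n ih =>
    rw [pow_succ f (n + 1), ← mul_assoc, ih, add_mul, mul_assoc, h1, smul_mul_assoc, mul_assoc (f ^ n),
      sub_mul, h2]
    simp only [mul_add, mul_sub, smul_mul_assoc, one_mul, mul_smul_comm, mul_one, ← mul_assoc, ← pow_succ]
    push_cast
    module

theorem prod_kill {V : Type*} [AddCommGroup V] [Module ℂ V]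
    (h e f : End ℂ V) (he : h * e - e * h = (2 : ℂ) • e) (hf : h * f - f * h = (-2 : ℂ) • f)
    (hef : e * f - f * e = h) (n : ℕ) : ∀ w : V, e w = 0 → (f ^ n) w = 0 →
    (Polynomial.aeval h (∏ i ∈ Finset.range n, (Polynomial.X - Polynomial.C (i : ℂ)))) w = 0 := by
  have key : ∀ n : ℕ, ∀ w : V, e w = 0 → ∃ a : ℂ, a ≠ 0 ∧ (e ^ n) ((f ^ n) w) =
    a • (Polynomial.aeval h (∏ i ∈ Finset.range n, (Polynomial.X - Polynomial.C (i : ℂ)))) w := by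
    intro n
    induction n with
    | zero => intro w _; exact ⟨1, one_ne_zero, by simp⟩
    | succ n ih =>
      intro w hw
      have h1 := congrArg (fun g => g w) (ef_formula h e f hf hef n)
      simp only [Module.End.mul_apply, LinearMap.add_apply, hw, map_zero, zero_add, LinearMap.smul_apply] at h1
      have h2 : e ((h - (n : ℂ) • (1 : End ℂ V)) w) = 0 := by
        have := congrArg (fun g => g w) he
        simp [hw] at this
        simp [hw, this]
      obtain ⟨a, ha, h3⟩ := ih _ h2
      refine ⟨(n + 1) * a, mul_ne_zero (by exact_mod_cast Nat.succ_ne_zero n) ha, ?_⟩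
      rw [pow_succ e, Module.End.mul_apply, h1, map_smul, h3, smul_smul, Finset.prod_range_succ,
        map_mul, Module.End.mul_apply]
      congr 2
      simp [Nat.cast_smul_eq_nsmul ℂ]
  intro w hw hfw
  obtain ⟨a, ha, h1⟩ := key n w hw
  rw [hfw, map_zero] at h1
  exact (smul_eq_zero.mp h1.symm).resolve_left ha
  
theorem highest {V : Type*} [AddCommGroup V] [Module ℂ V] [FiniteDimensional ℂ V]
    (h e f : End ℂ V) (he : h * e - e * h = (2 : ℂ) • e) (hf : h * f - f * h = (-2 : ℂ) • f)
    (hef : e * f - f * e = h) (μ : ℂ) (w : V) (hw : w ∈ h.maxGenEigenspace μ) (hew : e w = 0) (hw0 : w ≠ 0) :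
    h w = μ • w ∧ ∃ m : ℕ, μ = m := by
  classical
  obtain ⟨n, hn⟩ := exists_pow_zero h f (-2) (by norm_num) hf μ w hw
  have hp := prod_kill h e f he hf hef n w hew hn
  rw [Module.End.mem_maxGenEigenspace] at hw
  obtain ⟨k, hk⟩ := hw
  have hk' : Polynomial.aeval h ((Polynomial.X - Polynomial.C μ) ^ k) w = 0 := by
    simpa [Algebra.algebraMap_eq_smul_one] using hk
  have cop : ∀ (p : Polynomial ℂ) (u : V), p.eval μ ≠ 0 → Polynomial.aeval h p u = 0 →
      Polynomial.aeval h ((Polynomial.X - Polynomial.C μ) ^ k) u = 0 → u = 0 := by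
    intro p u hpμ h1 h2
    have hc : IsCoprime ((Polynomial.X - Polynomial.C μ) ^ k) p := by
      apply IsCoprime.pow_left
      rw [(Polynomial.irreducible_X_sub_C μ).coprime_iff_not_dvd, Polynomial.dvd_iff_isRoot]
      exact hpμ
    obtain ⟨a, b, hab⟩ := hc
    have := congrArg (fun q => Polynomial.aeval h q u) hab
    simp only [map_add, map_mul, LinearMap.add_apply, Module.End.mul_apply, h1, h2, map_zero, map_one, Module.End.one_apply, add_zero] at this
    exact this.symm
  by_cases hm : ∃ m ∈ Finset.range n, μ = (m : ℂ)
  · obtain ⟨m, hmn, hm⟩ := hm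
    refine ⟨?_, m, hm⟩
    rw [← sub_eq_zero]
    apply cop (∏ i ∈ (Finset.range n).erase m, (Polynomial.X - Polynomial.C (i : ℂ)))
    · rw [Polynomial.eval_prod, Finset.prod_ne_zero_iff]
      intro i hi
      simp only [Polynomial.eval_sub, Polynomial.eval_X, Polynomial.eval_C, hm, sub_ne_zero]
      exact_mod_cast (Finset.ne_of_mem_erase hi).symm
    · rw [← Finset.prod_erase_mul _ _ hmn, map_mul, Module.End.mul_apply] at hp
      rw [← hp]; simp [hm, Nat.cast_smul_eq_nsmul ℂ]
    · have : h w - μ • w = Polynomial.aeval h (Polynomial.X - Polynomial.C μ) w := by simp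
      rw [this, ← Module.End.mul_apply, ← map_mul, mul_comm, map_mul, Module.End.mul_apply, hk', map_zero]
  · exfalso
    push Not at hm
    refine hw0 (cop _ w ?_ hp hk')
    rw [Polynomial.eval_prod, Finset.prod_ne_zero_iff]
    intro i hi
    simpa [sub_ne_zero] using hm i hi

theorem sl2_semisimple {V : Type*} [AddCommGroup V] [Module ℂ V] [FiniteDimensional ℂ V]
    (h e f : End ℂ V) (he : h * e - e * h = (2 : ℂ) • e) (hf : h * f - f * h = (-2 : ℂ) • f)
    (hef : e * f - f * e = h) : h.IsSemisimple := by
  let c : End ℂ V := (4 : ℂ) • (f * e) + h * h + (2 : ℂ) • h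
  have h1 : h * e = e * h + (2 : ℂ) • e := by rw [← he]; abel
  have h2 : h * f = f * h + (-2 : ℂ) • f := by rw [← hf]; abel
  have h3 : e * f = f * e + h := by rw [← hef]; abel
  have hch : Commute c h := by
    change c * h = h * c
    simp only [c, add_mul, mul_add, smul_mul_assoc, mul_smul_comm, ← mul_assoc, h2]
    simp only [add_mul, mul_assoc, h1, smul_mul_assoc, mul_add, mul_smul_comm]
    module
  have hce : c * e - e * c = (0 : ℂ) • e := by
    simp only [c, add_mul, mul_add, smul_mul_assoc, mul_smul_comm, ← mul_assoc, h3]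
    simp only [add_mul, mul_assoc, h1, smul_mul_assoc, mul_add, mul_smul_comm]
    simp only [add_mul, ← mul_assoc, h1, smul_mul_assoc, mul_add, mul_smul_comm]
    module
  have joint : ∀ γ μ v, v ∈ h.maxGenEigenspace μ → v ∈ c.maxGenEigenspace γ → h v = μ • v := by
    intro γ μ v hv hv'
    have first : ∀ u, u ≠ 0 → u ∈ h.maxGenEigenspace μ → u ∈ c.maxGenEigenspace γ →
        ∃ j m : ℕ, (e ^ j) u ≠ 0 ∧ h ((e ^ j) u) = (μ + j * 2) • (e ^ j) u ∧
          μ + j * 2 = m ∧ γ = m * (m + 2) := by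
      intro u hu0 hu hu'
      have hex := exists_pow_zero h e 2 (by norm_num) he μ u hu
      obtain ⟨j, hj, hj'⟩ := Nat.exists_not_and_succ_of_not_zero_of_exists (p := fun n => (e ^ n) u = 0)
        (by simpa using hu0) hex
      rw [pow_succ', Module.End.mul_apply] at hj'
      have hg := pow_gen h e 2 he μ u hu j
      obtain ⟨h4, m, hm⟩ := highest h e f he hf hef _ _ hg hj' hj
      refine ⟨j, m, hj, h4, hm, ?_⟩
      have hg' := pow_gen c e 0 hce γ u hu' j
      have h5 : c ((e ^ j) u) = ((m : ℂ) * (m + 2)) • (e ^ j) u := by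
        simp only [c, LinearMap.add_apply, LinearMap.smul_apply, Module.End.mul_apply, hj', map_zero,
          h4, map_smul, hm]
        module
      simp only [mul_zero, add_zero] at hg'
      by_contra hne
      have hd := Module.End.disjoint_genEigenspace c hne ⊤ 1
      exact hj ((Submodule.disjoint_def.mp hd) _ hg' (by
        rw [← Module.End.eigenspace, Module.End.mem_eigenspace_iff]; exact h5))
    by_contra hne
    have hv0 : v ≠ 0 := by rintro rfl; simp at hne
    have hu0 : h v - μ • v ≠ 0 := sub_ne_zero.mpr hne
    have hu : h v - μ • v ∈ h.maxGenEigenspace μ := by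
      refine sub_mem ?_ (Submodule.smul_mem _ _ hv)
      exact Module.End.mapsTo_maxGenEigenspace_of_comm (Commute.refl h) μ hv
    have hu' : h v - μ • v ∈ c.maxGenEigenspace γ := by
      refine sub_mem ?_ (Submodule.smul_mem _ _ hv')
      exact Module.End.mapsTo_maxGenEigenspace_of_comm hch γ hv'
    obtain ⟨j, m, -, hj, hjm, hγ⟩ := first v hv0 hv hv'
    obtain ⟨j', m', hj0', -, hjm', hγ'⟩ := first _ hu0 hu hu'
    have hmm : m = m' := by
      have : m * (m + 2) = m' * (m' + 2) := by
        have := hγ.symm.trans hγ'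
        exact_mod_cast this
      nlinarith
    subst hmm
    have hjj : j = j' := by
      have := hjm.trans hjm'.symm
      simpa using this
    subst hjj
    apply hj0'
    have comm : ∀ n : ℕ, ∀ x, (e ^ n) (h x) = h ((e ^ n) x) - ((n : ℂ) * 2) • (e ^ n) x := by
      intro n
      induction n with
      | zero => simp
      | succ n ih =>
        intro x
        have h4 := congrArg (fun g => g ((e ^ n) x)) h1
        simp only [Module.End.mul_apply, LinearMap.add_apply, LinearMap.smul_apply] at h4
        rw [pow_succ', Module.End.mul_apply, Module.End.mul_apply, ih, h4, map_sub, map_smul]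
        push_cast; module
    rw [map_sub, map_smul, comm, hj]
    module
  apply isSemisimple_of_iSup_eigenspace
  let F : Bool → End ℂ V := fun b => if b then h else c
  have htop := Module.End.iSup_iInf_maxGenEigenspace_eq_top_of_iSup_maxGenEigenspace_eq_top_of_commute F
    (by
      intro i j _
      cases i <;> cases j <;> simp [F, hch, hch.symm])
    (fun i => Module.End.iSup_maxGenEigenspace_eq_top (F i))
  rw [eq_top_iff, ← htop]
  refine iSup_le fun χ => ?_
  refine le_trans ?_ (le_iSup _ (χ true))
  intro v hv
  rw [Submodule.mem_iInf] at hv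
  rw [Module.End.mem_eigenspace_iff]
  exact joint (χ false) (χ true) v (by simpa [F] using hv true) (by simpa [F] using hv false)


open NormedSpace Filter Topology in
theorem exp_transfer {𝔸 𝔹 Y : Type*} [NormedRing 𝔸] [NormedAlgebra ℂ 𝔸] [CompleteSpace 𝔸]
    [NormedRing 𝔹] [NormedAlgebra ℂ 𝔹] [CompleteSpace 𝔹] [NormedAddCommGroup Y] [NormedSpace ℂ Y]
    (Φ : 𝔸 →L[ℂ] Y) (Ψ : 𝔹 →L[ℂ] Y) (x : 𝔸) (y : 𝔹) (h : ∀ n : ℕ, Φ (x ^ n) = Ψ (y ^ n)) :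
    Φ (exp x) = Ψ (exp y) := by
  have h1 := (NormedSpace.exp_series_hasSum_exp' (𝕂 := ℂ) x).mapL Φ
  have h2 := (NormedSpace.exp_series_hasSum_exp' (𝕂 := ℂ) y).mapL Ψ
  simp only [map_smul, h] at h1 h2
  exact h1.unique h2

open NormedSpace Filter Topology in
theorem exp_conj_aux {B : Type*} [NormedRing B] [NormedAlgebra ℂ B] [CompleteSpace B] (a b : B) :
    exp (ContinuousLinearMap.mul ℂ B a + -(ContinuousLinearMap.mul ℂ B).flip a) b
      = exp a * b * exp (-a) := by
  let La : B →L[ℂ] B := ContinuousLinearMap.mul ℂ B a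
  let Ra : B →L[ℂ] B := (ContinuousLinearMap.mul ℂ B).flip a
  have hLa : ∀ b, La b = a * b := fun b => rfl
  have hRa : ∀ b, Ra b = b * a := fun b => rfl
  have hcomm : Commute La (-Ra) := by
    refine ContinuousLinearMap.ext fun b => ?_
    simp [hLa, hRa, mul_assoc]
  have e2 : ∀ b : B, exp La b = exp a * b := by
    intro b
    refine exp_transfer (ContinuousLinearMap.apply ℂ B b) ((ContinuousLinearMap.mul ℂ B).flip b) La a
      fun n => ?_
    simp only [ContinuousLinearMap.apply_apply, ContinuousLinearMap.flip_apply, ContinuousLinearMap.mul_apply']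
    induction n with
    | zero => simp
    | succ n ih =>
      rw [pow_succ', pow_succ', mul_apply_eq_comp, ih, hLa, mul_assoc]
  have e3 : ∀ b : B, exp (-Ra) b = b * exp (-a) := by
    intro b
    refine exp_transfer (ContinuousLinearMap.apply ℂ B b) ((ContinuousLinearMap.mul ℂ B) b) (-Ra) (-a)
      fun n => ?_
    simp only [ContinuousLinearMap.apply_apply, ContinuousLinearMap.mul_apply']
    induction n with
    | zero => simp
    | succ n ih =>
      rw [pow_succ', pow_succ, mul_apply_eq_comp, ih, neg_apply, hRa, mul_neg, mul_neg,
        mul_assoc]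
  have e4 : exp (La + -Ra) = exp La * exp (-Ra) := by
    let : NormedAlgebra ℚ (B →L[ℂ] B) := NormedAlgebra.restrictScalars ℚ ℂ _
    exact exp_add_of_commute hcomm
  change exp (La + -Ra) b = _
  rw [e4, mul_apply_eq_comp, e3, e2, mul_assoc]

open NormedSpace Filter Topology in
theorem exp_transfer' {𝔸 B : Type*} [NormedRing 𝔸] [NormedAlgebra ℂ 𝔸] [CompleteSpace 𝔸]
    [NormedAddCommGroup B] [NormedSpace ℂ B] [CompleteSpace B]
    (Φ : 𝔸 →L[ℂ] B) (D : B →L[ℂ] B) (w : B) (x : 𝔸) (h0 : Φ 1 = w)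
    (h : ∀ n : ℕ, Φ (x ^ (n + 1)) = D (Φ (x ^ n))) :
    Φ (exp x) = exp D w := by
  refine exp_transfer Φ (ContinuousLinearMap.apply ℂ B w) x D fun n => ?_
  simp only [ContinuousLinearMap.apply_apply]
  induction n with
  | zero => simpa using h0
  | succ n ih => rw [h, ih, pow_succ', mul_apply_eq_comp]

open NormedSpace Filter Topology in
theorem ad_exp {E : Type*} [NormedAddCommGroup E] [NormedSpace ℂ E] [CompleteSpace E]
    (A : E →L[ℂ] (E →L[ℂ] E)) (hA : ∀ z y, A (A z y) = A z * A y - A y * A z) (z v : E) :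
    A (exp (A z) v) = exp (A z) * A v * exp (-(A z)) := by
  rw [← exp_conj_aux]
  refine exp_transfer' (A.comp (ContinuousLinearMap.apply ℂ E v)) _ (A v) (A z) (by simp) fun n => ?_
  simp only [ContinuousLinearMap.comp_apply, ContinuousLinearMap.apply_apply]
  rw [pow_succ', mul_apply_eq_comp, hA]
  simp [sub_eq_add_neg]

open NormedSpace Filter Topology in
theorem open_orbit {E : Type*} [NormedAddCommGroup E] [NormedSpace ℂ E] [FiniteDimensional ℂ E]
    (A : E →L[ℂ] (E →L[ℂ] E)) (hA : ∀ z y, A (A z y) = A z * A y - A y * A z)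
    (K : Submodule ℂ E) (x : E) (hx : x ∈ K) (hsurj : ∀ v, ∃ k ∈ K, ∃ z, v = k + A z x) :
    ∀ᶠ y in 𝓝 x, ∃ k ∈ K, ∃ g g' : E →L[ℂ] E, g * g' = 1 ∧ g' * g = 1 ∧ A y = g * A k * g' := by
  have : CompleteSpace E := FiniteDimensional.complete ℂ E
  let f : K × E → E := fun p => exp (A p.2) (p.1 : E)
  let x0 : K × E := (⟨x, hx⟩, 0)
  have hexp : HasStrictFDerivAt (fun p : K × E => exp (A p.2))
      ((1 : (E →L[ℂ] E) →L[ℂ] (E →L[ℂ] E)).comp (A.comp (ContinuousLinearMap.snd ℂ K E))) x0 := by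
    have h0 : HasStrictFDerivAt (exp : (E →L[ℂ] E) → _) (1 : (E →L[ℂ] E) →L[ℂ] (E →L[ℂ] E)) (A x0.2) := by
      simp only [x0, map_zero]; exact hasStrictFDerivAt_exp_zero
    exact h0.comp (f := fun p : K × E => A p.2) x0
      (A.comp (ContinuousLinearMap.snd ℂ K E)).hasStrictFDerivAt
  have hfst : HasStrictFDerivAt (fun p : K × E => (p.1 : E))
      (K.subtypeL.comp (ContinuousLinearMap.fst ℂ K E)) x0 :=
    (K.subtypeL.comp (ContinuousLinearMap.fst ℂ K E)).hasStrictFDerivAt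
  have hf := hexp.clm_apply hfst
  have hmap := hf.map_nhds_eq_of_surj (by
    rw [LinearMap.range_eq_top]
    intro v
    obtain ⟨k, hk, z, rfl⟩ := hsurj v
    exact ⟨(⟨k, hk⟩, z), by simp [x0]⟩)
  have hx0 : exp (A x0.2) (x0.1 : E) = x := by simp [x0]
  rw [hx0] at hmap
  rw [← hmap, eventually_map]
  refine Eventually.of_forall fun p => ⟨p.1, p.1.2, exp (A p.2), exp (-(A p.2)), ?_, ?_, ad_exp A hA _ _⟩
  · let : NormedAlgebra ℚ (E →L[ℂ] E) := NormedAlgebra.restrictScalars ℚ ℂ _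
    rw [← exp_add_of_commute (Commute.neg_right (Commute.refl (A p.2)))]; simp
  · let : NormedAlgebra ℚ (E →L[ℂ] E) := NormedAlgebra.restrictScalars ℚ ℂ _
    rw [← exp_add_of_commute (Commute.neg_left (Commute.refl (A p.2)))]; simp

theorem exists_regular_in_cartan {L : Type*} [LieRing L] [LieAlgebra ℂ L] [FiniteDimensional ℂ L]
    [LieAlgebra.IsKilling ℂ L] (K : LieSubalgebra ℂ L) [K.IsCartanSubalgebra] :
    ∃ x ∈ K, K.toSubmodule ⊔ LinearMap.range (LieAlgebra.ad ℂ L x) = ⊤ := by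
  obtain ⟨x, hx⟩ := Module.Dual.exists_forall_ne_zero_of_forall_exists
    (fun α : {α : LieModule.Weight ℂ K L // α.IsNonZero} => (α.1.toLinear : Module.Dual ℂ K)) (by
      rintro ⟨α, hα⟩
      by_contra! h
      apply hα
      ext y
      exact h y)
  refine ⟨x, x.2, ?_⟩
  have htop := LieModule.iSup_genWeightSpace_eq_top' ℂ K L
  rw [← LieSubmodule.toSubmodule_inj, LieSubmodule.iSup_toSubmodule, LieSubmodule.top_toSubmodule] at htop
  rw [eq_top_iff, ← htop]
  refine iSup_le fun α v hv => ?_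
  by_cases hα : α.IsZero
  · apply Submodule.mem_sup_left
    have h0 : (α : K → ℂ) = 0 := hα
    rw [h0] at hv
    have : v ∈ LieAlgebra.rootSpace K (0 : K → ℂ) := hv
    rw [LieAlgebra.rootSpace_zero_eq] at this
    exact this
  · apply Submodule.mem_sup_right
    have h1 : ⁅x, v⁆ = α x • v := LieAlgebra.IsKilling.lie_eq_smul_of_mem_rootSpace hv x
    have h2 : α x ≠ 0 := hx ⟨α, hα⟩
    refine ⟨(α x)⁻¹ • v, ?_⟩
    have h3 : ⁅(x : L), v⁆ = α x • v := h1
    rw [map_smul, LieAlgebra.ad_apply, h3, smul_smul, inv_mul_cancel₀ h2, one_smul]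

theorem rank_le_cartan {L : Type*} [LieRing L] [LieAlgebra ℂ L] [FiniteDimensional ℂ L]
    [LieAlgebra.IsKilling ℂ L] (K : LieSubalgebra ℂ L) [K.IsCartanSubalgebra] :
    LieAlgebra.rank ℂ L ≤ finrank ℂ K := by
  obtain ⟨x, hx, htop⟩ := exists_regular_in_cartan K
  refine (LieAlgebra.rank_le_finrank_engel ℂ x).trans ?_
  have hss := LieAlgebra.IsKilling.isSemisimple_ad_of_mem_isCartanSubalgebra (K := ℂ) hx
  have h1 : (LieSubalgebra.engel ℂ x).toSubmodule ≤ LinearMap.ker (LieAlgebra.ad ℂ L x) := by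
    have := hss.isFinitelySemisimple.maxGenEigenspace_eq_eigenspace 0
    rw [Module.End.eigenspace_zero] at this
    rw [← this]
    exact le_rfl
  have h2 : finrank ℂ (LieSubalgebra.engel ℂ x) ≤ finrank ℂ (LinearMap.ker (LieAlgebra.ad ℂ L x)) :=
    Submodule.finrank_mono h1
  have h3 := LinearMap.finrank_range_add_finrank_ker (LieAlgebra.ad ℂ L x)
  have h4 := Submodule.finrank_add_le_finrank_add_finrank K.toSubmodule
    (LinearMap.range (LieAlgebra.ad ℂ L x))
  rw [htop, finrank_top] at h4
  have h5 : finrank ℂ K.toSubmodule = finrank ℂ K := rfl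
  omega

theorem exists_reg_poly (L : Type*) [LieRing L] [LieAlgebra ℂ L] [FiniteDimensional ℂ L] :
    ∃ P : MvPolynomial (Fin (finrank ℂ L)) ℂ, ∀ z : L, LieAlgebra.IsRegular ℂ z ↔
      MvPolynomial.eval ((Module.finBasis ℂ L).repr z) P ≠ 0 :=
  ⟨_, fun z => LieAlgebra.isRegular_iff_coeff_polyCharpoly_rank_ne_zero ℂ (Module.finBasis ℂ L) z⟩

theorem line_eval {n : ℕ} (P : MvPolynomial (Fin n) ℂ) (u v : Fin n → ℂ)
    (h : Set.Infinite {t : ℂ | MvPolynomial.eval (u + t • v) P = 0}) :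
    MvPolynomial.eval (u + v) P = 0 := by
  let q : Polynomial ℂ := MvPolynomial.aeval
    (fun i => Polynomial.C (u i) + Polynomial.X * Polynomial.C (v i)) P
  have hq : ∀ t : ℂ, q.eval t = MvPolynomial.eval (u + t • v) P := by
    intro t
    have : (Polynomial.evalRingHom t).comp (MvPolynomial.aeval (R := ℂ)
      (fun i => Polynomial.C (u i) + Polynomial.X * Polynomial.C (v i))).toRingHom
      = MvPolynomial.eval (u + t • v) := by
      ext i
      · simp
      · simp
        ring
    exact congrArg (fun r => r P) this
  have hroots : Set.Infinite {t | q.IsRoot t} := by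
    refine h.mono fun t ht => ?_
    change q.eval t = 0
    rw [hq]
    exact ht
  have hq0 := Polynomial.eq_zero_of_infinite_isRoot q hroots
  have := hq 1
  rw [hq0] at this
  simpa using this.symm

theorem line_regular {L : Type*} [LieRing L] [LieAlgebra ℂ L] [FiniteDimensional ℂ L] (x y : L)
    (h : Set.Infinite {t : ℂ | ¬ LieAlgebra.IsRegular ℂ (x + t • (y - x))}) :
    ¬ LieAlgebra.IsRegular ℂ y := by
  obtain ⟨P, hP⟩ := exists_reg_poly L
  rw [hP, not_not]
  have := line_eval P ((Module.finBasis ℂ L).repr x) ((Module.finBasis ℂ L).repr (y - x)) (by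
    refine h.mono fun t ht => ?_
    simp only [Set.mem_ofPred_eq, hP, not_not] at ht
    simp only [Set.mem_ofPred_eq]
    rw [← ht]
    congr 2
    ext i
    simp)
  rw [← this]
  congr 2
  ext i
  simp

set_option maxHeartbeats 1000000 in
open Filter Topology in
theorem cartan_le_rank {L : Type*} [LieRing L] [LieAlgebra ℂ L] [FiniteDimensional ℂ L]
    [LieAlgebra.IsKilling ℂ L] (K : LieSubalgebra ℂ L) [K.IsCartanSubalgebra] :
    finrank ℂ K ≤ LieAlgebra.rank ℂ L := by
  classical
  by_contra! hlt
  obtain ⟨x, hx, htop⟩ := exists_regular_in_cartan K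
  let b := Module.finBasis ℂ L
  let n := finrank ℂ L
  let φ : L ≃ₗ[ℂ] (Fin n → ℂ) := b.equivFun
  let A0 : (Fin n → ℂ) →ₗ[ℂ] ((Fin n → ℂ) →L[ℂ] (Fin n → ℂ)) :=
    { toFun := fun z => LinearMap.toContinuousLinearMap (φ.conj (LieAlgebra.ad ℂ L (φ.symm z)))
      map_add' := fun y z => by simp
      map_smul' := fun c z => by simp }
  let A : (Fin n → ℂ) →L[ℂ] ((Fin n → ℂ) →L[ℂ] (Fin n → ℂ)) := LinearMap.toContinuousLinearMap A0
  have hAapp : ∀ z v, A z v = φ ⁅φ.symm z, φ.symm v⁆ := fun z v => rfl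
  have hAlin : ∀ z, (A z : (Fin n → ℂ) →ₗ[ℂ] (Fin n → ℂ)) = φ.conj (LieAlgebra.ad ℂ L (φ.symm z)) :=
    fun z => rfl
  have hA : ∀ z y, A (A z y) = A z * A y - A y * A z := by
    intro z y
    ext1 v
    simp [hAapp]
  have hev := open_orbit A hA (K.toSubmodule.map (φ : L →ₗ[ℂ] (Fin n → ℂ))) (φ x)
    ⟨x, hx, rfl⟩ (by
      intro v
      have hv : φ.symm v ∈ K.toSubmodule ⊔ LinearMap.range (LieAlgebra.ad ℂ L x) := by
        rw [htop]; trivial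
      obtain ⟨k, hk, w, ⟨z, rfl⟩, hkz⟩ := Submodule.mem_sup.mp hv
      refine ⟨φ k, ⟨k, hk, rfl⟩, φ (-z), ?_⟩
      have hv2 : v = φ (k + LieAlgebra.ad ℂ L x z) := by rw [hkz]; simp
      rw [hAapp, hv2]
      simp)
  have hcoef : ∀ᶠ y in 𝓝 (φ x), (LieAlgebra.ad ℂ L (φ.symm y)).charpoly.coeff (LieAlgebra.rank ℂ L) = 0 := by
    filter_upwards [hev] with y hy
    obtain ⟨_, ⟨k, hk, rfl⟩, g, g', h1, h2, h3⟩ := hy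
    have h4 : (LieAlgebra.ad ℂ L (φ.symm y)).charpoly = (LieAlgebra.ad ℂ L k).charpoly := by
      let G : (Fin n → ℂ) ≃ₗ[ℂ] (Fin n → ℂ) := LinearEquiv.ofLinearMap (g : (Fin n → ℂ) →ₗ[ℂ] (Fin n → ℂ))
        (g' : (Fin n → ℂ) →ₗ[ℂ] (Fin n → ℂ))
        (LinearMap.ext fun v => congrArg (fun T : (Fin n → ℂ) →L[ℂ] (Fin n → ℂ) => T v) h1)
        (LinearMap.ext fun v => congrArg (fun T : (Fin n → ℂ) →L[ℂ] (Fin n → ℂ) => T v) h2)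
      rw [← LinearEquiv.charpoly_conj φ (LieAlgebra.ad ℂ L (φ.symm y)),
        ← LinearEquiv.charpoly_conj φ (LieAlgebra.ad ℂ L k), 
        ← LinearEquiv.charpoly_conj G (φ.conj (LieAlgebra.ad ℂ L k))]
      congr 1
      rw [← hAlin, h3]
      refine LinearMap.ext fun v => ?_
      have : (A (φ k) : (Fin n → ℂ) →ₗ[ℂ] (Fin n → ℂ)) = φ.conj (LieAlgebra.ad ℂ L k) := by
        rw [hAlin]; simp
      rw [← this]
      rfl
    rw [h4]
    apply Polynomial.coeff_eq_zero_of_lt_natTrailingDegree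
    rw [← LieAlgebra.finrank_engel]
    refine lt_of_lt_of_le hlt ?_
    have hle : K.toSubmodule ≤ (LieSubalgebra.engel ℂ k).toSubmodule := by
      intro u hu
      have hab : ⁅(⟨k, hk⟩ : K), (⟨u, hu⟩ : K)⁆ = 0 := trivial_lie_zero _ _ _ _
      have hab' : ⁅k, u⁆ = 0 := congrArg Subtype.val hab
      change u ∈ LieSubalgebra.engel ℂ k
      rw [LieSubalgebra.mem_engel_iff]
      exact ⟨1, by simpa using hab'⟩
    exact Submodule.finrank_mono hle
  obtain ⟨y, hy⟩ := LieAlgebra.exists_isRegular ℂ L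
  have hcont : Tendsto (fun t : ℂ => φ x + t • (φ (y - x))) (𝓝 0) (𝓝 (φ x)) := by
    have : Continuous (fun t : ℂ => φ x + t • (φ (y - x))) := by fun_prop
    simpa using this.tendsto 0
  have hz := hcont.eventually hcoef
  refine line_regular x y ?_ hy
  refine infinite_of_mem_nhds (0 : ℂ) ?_
  filter_upwards [hz] with t ht
  have e1 : φ.symm (φ x + t • φ (y - x)) = x + t • (y - x) := by
    rw [← map_smul, ← map_add, LinearEquiv.symm_apply_apply]
  rw [e1] at ht
  intro hr
  exact (LieAlgebra.isRegular_def ℂ _).mp hr ht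

theorem sl2_ad {L : Type*} [LieRing L] [LieAlgebra ℂ L] [FiniteDimensional ℂ L]
    (h e f : L) (he : ⁅h, e⁆ = (2 : ℂ) • e) (hf : ⁅h, f⁆ = (-2 : ℂ) • f) (hef : ⁅e, f⁆ = h) :
    (LieAlgebra.ad ℂ L h).IsSemisimple := by
  refine sl2_semisimple _ (LieAlgebra.ad ℂ L e) (LieAlgebra.ad ℂ L f) ?_ ?_ ?_
  · ext v
    simp only [LinearMap.sub_apply, Module.End.mul_apply, LieAlgebra.ad_apply, LinearMap.smul_apply]
    rw [← smul_lie, ← he, lie_lie]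
  · ext v
    simp only [LinearMap.sub_apply, Module.End.mul_apply, LieAlgebra.ad_apply, LinearMap.smul_apply]
    rw [← smul_lie, ← hf, lie_lie]
  · ext v
    simp only [LinearMap.sub_apply, Module.End.mul_apply, LieAlgebra.ad_apply]
    rw [← lie_lie, hef]

theorem ad_coroot_ss {L : Type*} [LieRing L] [LieAlgebra ℂ L] [FiniteDimensional ℂ L]
    (F : LieSubalgebra ℂ L) [LieAlgebra.IsKilling ℂ F] (HF : LieSubalgebra ℂ F)
    [HF.IsCartanSubalgebra] (α : LieModule.Weight ℂ HF F) (hα : α.IsNonZero) :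
    (LieAlgebra.ad ℂ L (((LieAlgebra.IsKilling.coroot α : HF) : F) : L)).IsSemisimple := by
  obtain ⟨h, e, f, ht, he, hf⟩ := LieAlgebra.IsKilling.exists_isSl2Triple_of_weight_isNonZero hα
  have hc := IsSl2Triple.h_eq_coroot hα ht he hf
  rw [← hc]
  have h1 := congrArg (Subtype.val : F → L) ht.lie_e_f
  have h2 := congrArg (Subtype.val : F → L) ht.lie_h_e_nsmul
  have h3 := congrArg (Subtype.val : F → L) ht.lie_h_f_nsmul
  refine sl2_ad (h : L) (e : L) (f : L) ?_ ?_ h1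
  · simpa [two_smul] using h2
  · simpa [two_smul, neg_smul, add_comm] using h3

theorem ad_cartan_ss {L : Type*} [LieRing L] [LieAlgebra ℂ L] [FiniteDimensional ℂ L]
    (F : LieSubalgebra ℂ L) [LieAlgebra.IsKilling ℂ F] (HF : LieSubalgebra ℂ F)
    [HF.IsCartanSubalgebra] (y : HF) :
    (LieAlgebra.ad ℂ L ((y : F) : L)).IsSemisimple := by
  have hspan := LieAlgebra.IsKilling.span_weight_isNonZero_eq_top ℂ F HF
  have hy : LieAlgebra.IsKilling.cartanEquivDual HF y ∈ Submodule.span ℂ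
    ({α : LieModule.Weight ℂ HF F | α.IsNonZero}.image (LieModule.Weight.toLinear ℂ HF F)) := by
    rw [hspan]; trivial
  have key : ∀ φ : Dual ℂ HF, φ ∈ Submodule.span ℂ
      ({α : LieModule.Weight ℂ HF F | α.IsNonZero}.image (LieModule.Weight.toLinear ℂ HF F)) →
      (LieAlgebra.ad ℂ L ((((LieAlgebra.IsKilling.cartanEquivDual HF).symm φ : HF) : F) : L)).IsSemisimple := by
    intro φ hφ
    induction hφ using Submodule.span_induction with
    | mem φ h =>
      obtain ⟨α, hα, rfl⟩ := h
      have h1 := ad_coroot_ss F HF α hα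
      have h2 := LieAlgebra.IsKilling.root_apply_cartanEquivDual_symm_ne_zero hα
      have h3 : (LieAlgebra.IsKilling.cartanEquivDual HF).symm (LieModule.Weight.toLinear ℂ HF F α) =
          (2⁻¹ * α ((LieAlgebra.IsKilling.cartanEquivDual HF).symm (LieModule.Weight.toLinear ℂ HF F α))) •
            LieAlgebra.IsKilling.coroot α := by
        rw [LieAlgebra.IsKilling.coroot, ← Nat.cast_smul_eq_nsmul ℂ, smul_smul, smul_smul]
        rw [show (2⁻¹ * α ((LieAlgebra.IsKilling.cartanEquivDual HF).symm (LieModule.Weight.toLinear ℂ HF F α))) * ((2 : ℕ) : ℂ) *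
          (α ((LieAlgebra.IsKilling.cartanEquivDual HF).symm (LieModule.Weight.toLinear ℂ HF F α)))⁻¹ = 1 by
          field_simp; simp, one_smul]
      rw [h3]
      have h4 := Module.End.IsSemisimple_smul (2⁻¹ * α ((LieAlgebra.IsKilling.cartanEquivDual HF).symm (LieModule.Weight.toLinear ℂ HF F α))) h1
      rw [← map_smul] at h4
      exact h4
    | zero => simp
    | add φ ψ _ _ h1 h2 =>
      have hab : ⁅(LieAlgebra.IsKilling.cartanEquivDual HF).symm φ, (LieAlgebra.IsKilling.cartanEquivDual HF).symm ψ⁆ = 0 :=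
        trivial_lie_zero _ _ _ _
      have hab2 := congrArg (fun z : HF => ((z : F) : L)) hab
      simp only [LieSubalgebra.coe_bracket, ZeroMemClass.coe_zero] at hab2
      have := Module.End.IsSemisimple.add_of_commute (by
        refine LinearMap.ext fun v => ?_
        simp only [Module.End.mul_apply, LieAlgebra.ad_apply]
        rw [← sub_eq_zero, ← lie_lie, hab2, zero_lie]) h1 h2
      rw [← map_add] at this
      rw [map_add]
      exact this
    | smul c φ _ h1 =>
      have h4 := Module.End.IsSemisimple_smul c h1
      rw [← map_smul] at h4
      rw [map_smul]
      exact h4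
  simpa using key _ hy

/-- The centralizer of a subalgebra. -/
def centr {L : Type*} [LieRing L] [LieAlgebra ℂ L] (H : LieSubalgebra ℂ L) : LieSubalgebra ℂ L where
  carrier := {y | ∀ h ∈ H, ⁅h, y⁆ = 0}
  add_mem' := fun ha hb h hh => by rw [lie_add, ha h hh, hb h hh, add_zero]
  zero_mem' := fun h _ => lie_zero h
  smul_mem' := fun c x hx h hh => by rw [lie_smul, hx h hh, smul_zero]
  lie_mem' := fun {x y} hx hy h hh => by rw [leibniz_lie, hx h hh, hy h hh, zero_lie, lie_zero, add_zero]

theorem mem_centr {L : Type*} [LieRing L] [LieAlgebra ℂ L] (H : LieSubalgebra ℂ L) (y : L) :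
    y ∈ centr H ↔ ∀ h ∈ H, ⁅h, y⁆ = 0 := Iff.rfl

theorem exists_cartan_ge {L : Type*} [LieRing L] [LieAlgebra ℂ L] [FiniteDimensional ℂ L]
    (H : LieSubalgebra ℂ L) (hab : ∀ x ∈ H, ∀ y ∈ H, ⁅x, y⁆ = 0)
    (hss : ∀ x ∈ H, (LieAlgebra.ad ℂ L x).IsSemisimple) :
    ∃ K : LieSubalgebra ℂ L, K.IsCartanSubalgebra ∧ H ≤ K := by
  obtain ⟨z, hz⟩ := LieAlgebra.exists_isCartanSubalgebra_engel ℂ (centr H)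
  set KC := LieSubalgebra.engel ℂ z
  have hinj : Function.Injective (centr H).incl := Subtype.val_injective
  have hmem : ∀ y, y ∈ KC.map (centr H).incl ↔ ∃ hy : y ∈ centr H, (⟨y, hy⟩ : centr H) ∈ KC := by
    intro y
    rw [LieSubalgebra.mem_map]
    constructor
    · rintro ⟨w, hw, rfl⟩
      exact ⟨w.2, hw⟩
    · rintro ⟨hy, hw⟩
      exact ⟨_, hw, rfl⟩
  have hHK : H ≤ KC.map (centr H).incl := by
    intro h hh
    have hc : h ∈ centr H := fun x hx => hab x hx h hh
    rw [hmem]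
    refine ⟨hc, ?_⟩
    rw [← hz.self_normalizing, LieSubalgebra.mem_normalizer_iff]
    intro y hy
    have : ⁅(⟨h, hc⟩ : centr H), y⁆ = 0 := Subtype.ext (y.2 h hh)
    rw [this]
    exact KC.zero_mem
  refine ⟨KC.map (centr H).incl, ⟨?_, ?_⟩, hHK⟩
  · have := hz.nilpotent
    exact (LieEquiv.nilpotent_iff_equiv_nilpotent
      (LieSubalgebra.equivMapOfInjective (centr H).incl KC hinj)).mp this
  · refine le_antisymm ?_ (LieSubalgebra.le_normalizer _)
    intro n hn
    rw [LieSubalgebra.mem_normalizer_iff] at hn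
    have hnc : n ∈ centr H := by
      intro h hh
      have h1 := hn h (hHK hh)
      obtain ⟨h2, -⟩ := (hmem _).mp h1
      have h3 : ⁅h, ⁅h, n⁆⁆ = 0 := by
        have := h2 h hh
        rw [← lie_skew h n, lie_neg, this, neg_zero]
      have h4 := (hss h hh).isFinitelySemisimple.maxGenEigenspace_eq_eigenspace 0
      have h5 : n ∈ (LieAlgebra.ad ℂ L h).maxGenEigenspace 0 := by
        rw [Module.End.mem_maxGenEigenspace]
        refine ⟨2, ?_⟩
        simpa [pow_two] using h3
      rw [h4, Module.End.eigenspace_zero] at h5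
      exact h5
    rw [hmem]
    refine ⟨hnc, ?_⟩
    rw [← hz.self_normalizing, LieSubalgebra.mem_normalizer_iff]
    intro y hy
    obtain ⟨h1, h2⟩ := (hmem _).mp (hn y ((hmem y).mpr ⟨y.2, hy⟩))
    exact h2

theorem image_isCartan {L : Type*} [LieRing L] [LieAlgebra ℂ L] [FiniteDimensional ℂ L]
    [LieAlgebra.IsKilling ℂ L]
    (F : LieSubalgebra ℂ L) [LieAlgebra.IsKilling ℂ F] (HF : LieSubalgebra ℂ F)
    [HF.IsCartanSubalgebra] (HL : LieSubalgebra ℂ L) [HL.IsCartanSubalgebra]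
    (hr : finrank ℂ HF = finrank ℂ HL) : (HF.map F.incl).IsCartanSubalgebra := by
  obtain ⟨K, hK, hle⟩ := exists_cartan_ge (HF.map F.incl) (by
    rintro _ ⟨x, hx, rfl⟩ _ ⟨y, hy, rfl⟩
    have hab : ⁅(⟨x, hx⟩ : HF), (⟨y, hy⟩ : HF)⁆ = 0 := trivial_lie_zero _ _ _ _
    exact congrArg (fun z : HF => ((z : F) : L)) hab) (by
    rintro _ ⟨x, hx, rfl⟩
    exact ad_cartan_ss F HF ⟨x, hx⟩)
  have h1 := cartan_le_rank K
  have h2 := rank_le_cartan HL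
  have h3 : finrank ℂ (HF.map F.incl) = finrank ℂ HF :=
    ((LieSubalgebra.equivMapOfInjective F.incl HF Subtype.val_injective).toLinearEquiv.finrank_eq).symm
  have h4 : (HF.map F.incl).toSubmodule = K.toSubmodule := by
    apply Submodule.eq_of_le_of_finrank_le hle
    change finrank ℂ K ≤ finrank ℂ (HF.map F.incl)
    omega
  have h5 : HF.map F.incl = K := LieSubalgebra.toSubmodule_injective h4
  rw [h5]
  exact hK

end helpers

theorem full_rank_semisimple_subalgebra_is_regular
    {L : Type*} [LieRing L] [LieAlgebra ℂ L] [FiniteDimensional ℂ L]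
    [LieAlgebra.IsSemisimple ℂ L]
    (F : LieSubalgebra ℂ L) [LieAlgebra.IsSemisimple ℂ F]
    (hrank : ∃ (HF : LieSubalgebra ℂ F) (HL : LieSubalgebra ℂ L),
        HF.IsCartanSubalgebra ∧ HL.IsCartanSubalgebra ∧
        Module.finrank ℂ HF = Module.finrank ℂ HL) :
    ∃ H : LieSubalgebra ℂ L, H.IsCartanSubalgebra ∧
      F.toSubmodule = (H.toSubmodule ⊓ F.toSubmodule) ⊔
        ⨆ α ∈ {α : H →ₗ[ℂ] ℂ | α ≠ 0 ∧ simRootSpace H α ≠ ⊥},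
          (simRootSpace H α ⊓ F.toSubmodule) := by
  obtain ⟨HF, HL, hHF, hHL, hr⟩ := hrank
  refine ⟨HF.map F.incl, image_isCartan F HF HL hr, le_antisymm ?_ ?_⟩
  · intro v hvF
    have htop := LieModule.iSup_genWeightSpace_eq_top' ℂ HF F
    rw [← LieSubmodule.toSubmodule_inj, LieSubmodule.iSup_toSubmodule,
      LieSubmodule.top_toSubmodule] at htop
    have hv : (⟨v, hvF⟩ : F) ∈ (⊤ : Submodule ℂ F) := trivial
    have hv2 : v ∈ (⊤ : Submodule ℂ F).map (F.incl : F →ₗ[ℂ] L) := ⟨⟨v, hvF⟩, hv, rfl⟩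
    rw [← htop, Submodule.map_iSup] at hv2
    refine (iSup_le ?_ : (iSup _ : Submodule ℂ L) ≤ _) hv2
    rintro α _ ⟨(w : F), hw, rfl⟩
    by_cases hα : α.IsZero
    · apply Submodule.mem_sup_left
      have h0 : (α : HF → ℂ) = 0 := hα
      rw [h0] at hw
      have : w ∈ LieAlgebra.rootSpace HF (0 : HF → ℂ) := hw
      rw [LieAlgebra.rootSpace_zero_eq] at this
      exact ⟨⟨w, this, rfl⟩, w.2⟩
    · by_cases hw0 : w = 0
      · rw [hw0, map_zero]
        exact Submodule.zero_mem _
      apply Submodule.mem_sup_right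
      let e := (LieSubalgebra.equivMapOfInjective F.incl HF Subtype.val_injective).toLinearEquiv
      have hsim : (w : L) ∈ simRootSpace (HF.map F.incl) (α.toLinear ∘ₗ e.symm.toLinearMap) := by
        intro h
        obtain ⟨y, rfl⟩ := e.surjective h
        have h1 : ⁅y, w⁆ = α y • w := LieAlgebra.IsKilling.lie_eq_smul_of_mem_rootSpace hw y
        have h2 : ⁅((y : F) : L), (w : L)⁆ = α y • (w : L) := congrArg (Subtype.val : F → L) h1
        have h3 : ((e y : HF.map F.incl) : L) = ((y : F) : L) := rfl
        rw [h3, h2]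
        simp
      refine Submodule.mem_iSup_of_mem _ (Submodule.mem_iSup_of_mem ⟨?_, ?_⟩ ⟨hsim, w.2⟩)
      · intro h0
        apply hα
        ext y
        have := congrArg (fun f => f (e y)) h0
        simpa using this
      · intro hbot
        rw [hbot] at hsim
        exact hw0 (Subtype.ext hsim)
  · refine sup_le inf_le_right (iSup₂_le fun α _ => inf_le_right)
end

section
/- Let 𝔤 be a finite-dimensional complex semisimple Lie algebra and let n ∈ ℕ. If there exists an injective homomorphism of complex Lie algebras from the n-fold direct sum (sl₂(ℂ))^n into 𝔤, then there exists an injective homomorphism of complex Lie algebras from (sl₂(ℂ))^n into 𝔤 whose image is a regular subalgebra of 𝔤, i.e. there is a Cartan subalgebra 𝔥 of 𝔤 such that the image 𝔣 satisfies 𝔣 = (𝔥 ∩ 𝔣) ⊕ ⨁_{α ∈ Φ} (𝔤_α ∩ 𝔣), where Φ is the root system of (𝔤, 𝔥). In other words, the maximal n such that (sl₂(ℂ))^n embeds as a regular subalgebra of 𝔤 is also maximal among all embeddings of (sl₂(ℂ))^n as a subalgebra. -/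
open scoped DirectSum

section ExtDer
variable {L : Type*} [AddCommGroup L] [Module ℂ L]

noncomputable def extHom (T : Module.End ℂ L) :
    ExteriorAlgebra ℂ L →ₐ[ℂ] TrivSqZeroExt (ExteriorAlgebra ℂ L) (ExteriorAlgebra ℂ L) :=
  ExteriorAlgebra.lift ℂ ⟨(TrivSqZeroExt.inlAlgHom ℂ (ExteriorAlgebra ℂ L) (ExteriorAlgebra ℂ L)).toLinearMap ∘ₗ
      ExteriorAlgebra.ι ℂ +
    (TrivSqZeroExt.inrHom (ExteriorAlgebra ℂ L) (ExteriorAlgebra ℂ L)).restrictScalars ℂ ∘ₗ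
      ExteriorAlgebra.ι ℂ ∘ₗ T, fun m => by
    ext
    · simp
    · simp [ExteriorAlgebra.ι_add_mul_swap]⟩

lemma extHom_ι (T : Module.End ℂ L) (m : L) : extHom T (ExteriorAlgebra.ι ℂ m) =
    TrivSqZeroExt.inl (ExteriorAlgebra.ι ℂ m) + TrivSqZeroExt.inr (ExteriorAlgebra.ι ℂ (T m)) := by
  simp [extHom]

lemma extHom_fst (T : Module.End ℂ L) (x) : (extHom T x).fst = x := by
  have : (TrivSqZeroExt.fstHom ℂ (ExteriorAlgebra ℂ L) (ExteriorAlgebra ℂ L)).comp (extHom T)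
      = AlgHom.id ℂ _ := by
    ext m
    simp [extHom_ι]
  exact DFunLike.congr_fun this x

noncomputable def extDer (T : Module.End ℂ L) : Module.End ℂ (ExteriorAlgebra ℂ L) :=
  (TrivSqZeroExt.sndHom (ExteriorAlgebra ℂ L) (ExteriorAlgebra ℂ L)).restrictScalars ℂ ∘ₗ
    (extHom T).toLinearMap

lemma extDer_ι (T : Module.End ℂ L) (m : L) :
    extDer T (ExteriorAlgebra.ι ℂ m) = ExteriorAlgebra.ι ℂ (T m) := by
  simp [extDer, extHom_ι]

lemma extDer_algebraMap (T : Module.End ℂ L) (c : ℂ) :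
    extDer T (algebraMap ℂ _ c) = 0 := by
  simp [extDer, TrivSqZeroExt.algebraMap_eq_inl']

lemma extDer_mul (T : Module.End ℂ L) (x y) :
    extDer T (x * y) = x * extDer T y + extDer T x * y := by
  simp [extDer, extHom_fst]

lemma extDer_one (T : Module.End ℂ L) : extDer T 1 = 0 := by
  simpa using extDer_algebraMap T 1

lemma extDer_add (S T : Module.End ℂ L) (x) : extDer (S + T) x = extDer S x + extDer T x := by
  induction x using ExteriorAlgebra.induction with
  | algebraMap r => simp [extDer_algebraMap]
  | ι x => simp [extDer_ι]
  | mul a b ha hb => simp only [extDer_mul, ha, hb]; noncomm_ring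
  | add a b ha hb => simp only [map_add, ha, hb]; abel

lemma extDer_smul (c : ℂ) (T : Module.End ℂ L) (x) : extDer (c • T) x = c • extDer T x := by
  induction x using ExteriorAlgebra.induction with
  | algebraMap r => simp [extDer_algebraMap]
  | ι x => simp [extDer_ι]
  | mul a b ha hb => simp only [extDer_mul, ha, hb, smul_add, mul_smul_comm, smul_mul_assoc]
  | add a b ha hb => simp only [map_add, ha, hb, smul_add]

lemma extDer_lie (S T : Module.End ℂ L) (x) :
    extDer (S * T - T * S) x = extDer S (extDer T x) - extDer T (extDer S x) := by
  induction x using ExteriorAlgebra.induction with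
  | algebraMap r => simp [extDer_algebraMap]
  | ι x => simp [extDer_ι]
  | mul a b ha hb => simp only [extDer_mul, ha, hb, map_add]; noncomm_ring
  | add a b ha hb => simp only [map_add, ha, hb]; abel

end ExtDer

section ExtMod
variable {L : Type*} [LieRing L] [LieAlgebra ℂ L]

noncomputable instance extLieRingModule : LieRingModule L (ExteriorAlgebra ℂ L) where
  bracket z x := extDer (LieAlgebra.ad ℂ L z) x
  add_lie z w x := by
    change extDer _ x = extDer _ x + extDer _ x
    rw [map_add, extDer_add]
  lie_add z x y := map_add _ _ _
  leibniz_lie z w x := by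
    change extDer _ (extDer _ x) = extDer _ x + extDer _ (extDer _ x)
    have : LieAlgebra.ad ℂ L ⁅z, w⁆ = LieAlgebra.ad ℂ L z * LieAlgebra.ad ℂ L w -
        LieAlgebra.ad ℂ L w * LieAlgebra.ad ℂ L z := by
      ext y
      simp
    rw [this, extDer_lie]
    abel

lemma ext_lie_def (z : L) (x : ExteriorAlgebra ℂ L) :
    ⁅z, x⁆ = extDer (LieAlgebra.ad ℂ L z) x := rfl

instance extLieModule : LieModule ℂ L (ExteriorAlgebra ℂ L) where
  smul_lie c z x := by rw [ext_lie_def, ext_lie_def, map_smul, extDer_smul]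
  lie_smul c z x := map_smul _ _ _

lemma ext_lie_mul (z : L) (x y : ExteriorAlgebra ℂ L) : ⁅z, x * y⁆ = x * ⁅z, y⁆ + ⁅z, x⁆ * y :=
  extDer_mul _ _ _
lemma ext_lie_ι (z m : L) : ⁅z, ExteriorAlgebra.ι ℂ m⁆ = ExteriorAlgebra.ι ℂ ⁅z, m⁆ :=
  extDer_ι _ _
lemma ext_lie_one (z : L) : ⁅z, (1 : ExteriorAlgebra ℂ L)⁆ = 0 := extDer_one _

instance extFinite [FiniteDimensional ℂ L] : FiniteDimensional ℂ (ExteriorAlgebra ℂ L) :=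
  Module.Finite.of_basis (Module.finBasis ℂ L).ExteriorAlgebra

lemma ext_lie_ιMulti (z : L) {d : ℕ} (v : Fin d → L) :
    ⁅z, ExteriorAlgebra.ιMulti ℂ d v⁆ =
      ∑ i, ExteriorAlgebra.ιMulti ℂ d (Function.update v i ⁅z, v i⁆) := by
  induction d with
  | zero => simp [ExteriorAlgebra.ιMulti_zero_apply, ext_lie_one]
  | succ d ih =>
    rw [ExteriorAlgebra.ιMulti_succ_apply, ext_lie_mul, ih, ext_lie_ι, Fin.sum_univ_succ,
      Finset.mul_sum, add_comm]
    congr 1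
    · rw [ExteriorAlgebra.ιMulti_succ_apply]
      simp [Matrix.vecTail, Function.comp_def]
    · refine Finset.sum_congr rfl fun i _ => ?_
      rw [ExteriorAlgebra.ιMulti_succ_apply]
      congr 2
      ext j
      simp [Matrix.vecTail, Function.update_apply]

lemma ext_ιMulti_ne_zero {d : ℕ} (v : Fin d → L) (hv : LinearIndependent ℂ v) :
    ExteriorAlgebra.ιMulti ℂ d v ≠ 0 := by
  obtain ⟨g, hg⟩ := LinearMap.exists_leftInverse_of_injective
    (Fintype.linearCombination ℂ v)
    (by rw [LinearMap.ker_eq_bot]; exact (linearIndependent_iff_injective_fintypeLinearCombination).1 hv)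
  intro h0
  have h1 := ExteriorAlgebra.liftAlternating_apply_ιMulti (R := ℂ)
    (Function.update (fun i => (0 : L [⋀^Fin i]→ₗ[ℂ] ℂ)) d
      ((Matrix.detRowAlternating (R := ℂ) (n := Fin d)).compLinearMap g)) v
  rw [h0, map_zero, Function.update_self] at h1
  have h2 : (fun i => g (v i)) = (1 : Matrix (Fin d) (Fin d) ℂ) := by
    ext1 i
    have := LinearMap.congr_fun hg (Pi.single i 1)
    simp at this
    rw [this]
    ext j
    simp [Matrix.one_apply, Pi.single_apply, eq_comm]
  have h3 : (0:ℂ) = Matrix.det (fun i => g (v i) : Matrix (Fin d) (Fin d) ℂ) := h1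
  rw [h2, Matrix.det_one] at h3
  exact zero_ne_one h3

lemma ext_lie_eig (z : L) {d : ℕ} (v : Fin d → L) (c : Fin d → ℂ) (h : ∀ i, ⁅z, v i⁆ = c i • v i) :
    ⁅z, ExteriorAlgebra.ιMulti ℂ d v⁆ = (∑ i, c i) • ExteriorAlgebra.ιMulti ℂ d v := by
  rw [ext_lie_ιMulti, Finset.sum_smul]
  refine Finset.sum_congr rfl fun i _ => ?_
  rw [h, AlternatingMap.map_update_smul, Function.update_eq_self]

lemma ext_lie_kill (z : L) {d : ℕ} (v : Fin d → L)
    (h : ∀ i, ⁅z, v i⁆ = 0 ∨ ∃ j, j ≠ i ∧ ∃ c : ℂ, ⁅z, v i⁆ = c • v j) :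
    ⁅z, ExteriorAlgebra.ιMulti ℂ d v⁆ = 0 := by
  rw [ext_lie_ιMulti]
  refine Finset.sum_eq_zero fun i _ => ?_
  rcases h i with h | ⟨j, hj, c, h⟩
  · rw [h, AlternatingMap.map_update_zero]
  · rw [h, AlternatingMap.map_update_smul, AlternatingMap.map_update_self _ _ hj.symm, smul_zero]
end ExtMod
section Sl2
open LieModule
variable {L V : Type*} [LieRing L] [LieAlgebra ℂ L] [AddCommGroup V] [Module ℂ V]
  [LieRingModule L V] [LieModule ℂ L V] [FiniteDimensional ℂ V] {h e f : L}

lemma sl2_exists_pow_zero (t : IsSl2Triple h e f) {v : V} {μ : ℂ} (hv : ⁅h, v⁆ = μ • v) :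
    ∃ k, (toEnd ℂ L V e ^ k) v = 0 := by
  by_contra! contra
  have hs : (Set.range (fun (n : ℕ) ↦ μ + 2 * n)).Infinite := by
    rw [Set.infinite_range_iff (fun n m ↦ by simp)]; infer_instance
  exact hs ((toEnd ℂ L V h).eigenvectors_linearIndependent
    {μ + 2 * n | n : ℕ}
    (fun s ↦ (toEnd ℂ L V e ^ (Classical.choose s.2)) v)
    (fun ⟨r, hr⟩ ↦ by simp [t.lie_h_pow_toEnd_e hv, Classical.choose_spec hr, contra,
      Module.End.hasEigenvector_iff])).finite

lemma sl2_exists_top (t : IsSl2Triple h e f) {v : V} {μ : ℂ} (hv : ⁅h, v⁆ = μ • v) (h0 : v ≠ 0) :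
    ∃ k : ℕ, t.HasPrimitiveVectorWith ((toEnd ℂ L V e ^ k) v) (μ + 2 * k) := by
  obtain ⟨k, hk1, hk2⟩ := Nat.exists_not_and_succ_of_not_zero_of_exists
    (p := fun k => (toEnd ℂ L V e ^ k) v = 0) (by simpa using h0) (sl2_exists_pow_zero t hv)
  refine ⟨k, hk1, t.lie_h_pow_toEnd_e hv k, ?_⟩
  rw [IsSl2Triple.lie_e_pow_toEnd_e]; exact hk2

lemma sl2_int (t : IsSl2Triple h e f) {v : V} {μ : ℂ} (hv : ⁅h, v⁆ = μ • v) (h0 : v ≠ 0) :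
    ∃ m : ℤ, μ = m := by
  obtain ⟨k, hk⟩ := sl2_exists_top t hv h0
  obtain ⟨n, hn⟩ := hk.exists_nat
  exact ⟨n - 2 * k, by push_cast; rw [← hn]; ring⟩

lemma lie_pow_shift {a z : L} {b : ℂ} (hz : ⁅a, z⁆ = b • z) {v : V} {c : ℂ} (hv : ⁅a, v⁆ = c • v)
    (k : ℕ) : ⁅a, (toEnd ℂ L V z ^ k) v⁆ = (c + k * b) • (toEnd ℂ L V z ^ k) v := by
  induction k with
  | zero => simpa using hv
  | succ k ih =>
    rw [pow_succ', Module.End.mul_apply, toEnd_apply_apply, leibniz_lie, hz, ih, lie_smul,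
      smul_lie, ← add_smul]
    congr 1
    push_cast; ring

lemma sl2_reflect_aux (t : IsSl2Triple h e f) {ι : Type*} (a : ι → L) (β ν : ι → ℂ)
    (hae : ∀ i, ⁅a i, e⁆ = β i • e) (haf : ∀ i, ⁅a i, f⁆ = -β i • f) {v : V} (h0 : v ≠ 0)
    (hv : ∀ i, ⁅a i, v⁆ = ν i • v) (m : ℕ) (hm : ⁅h, v⁆ = (m : ℂ) • v) :
    ∃ v' : V, v' ≠ 0 ∧ ∀ i, ⁅a i, v'⁆ = (ν i - m * β i) • v' := by
  obtain ⟨k, hk⟩ := sl2_exists_top t hm h0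
  refine ⟨(toEnd ℂ L V f ^ (m + k)) ((toEnd ℂ L V e ^ k) v), 
    hk.pow_toEnd_f_ne_zero_of_eq_nat (n := m + 2 * k) (by push_cast; ring) (by lia), fun i => ?_⟩
  rw [lie_pow_shift (haf i) (lie_pow_shift (hae i) (hv i) k)]
  congr 1
  push_cast; ring

lemma sl2_reflect (t : IsSl2Triple h e f) {ι : Type*} (a : ι → L) (β ν : ι → ℂ)
    (hae : ∀ i, ⁅a i, e⁆ = β i • e) (haf : ∀ i, ⁅a i, f⁆ = -β i • f) {v : V} (h0 : v ≠ 0)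
    (hv : ∀ i, ⁅a i, v⁆ = ν i • v) (m : ℂ) (hm : ⁅h, v⁆ = m • v) :
    ∃ v' : V, v' ≠ 0 ∧ ∀ i, ⁅a i, v'⁆ = (ν i - m * β i) • v' := by
  obtain ⟨z, rfl⟩ := sl2_int t hm h0
  rcases Int.eq_nat_or_neg z with ⟨n, rfl | rfl⟩
  · exact sl2_reflect_aux t a β ν hae haf h0 hv n (by simpa using hm)
  · obtain ⟨v', h1, h2⟩ := sl2_reflect_aux t.symm a (-β) ν haf (by simpa using hae) h0 hv n 
      (by simp [hm])
    exact ⟨v', h1, fun i => by rw [h2]; congr 1; simp⟩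

lemma sl2_ss1 (t : IsSl2Triple h e f) {w w' : V} {m : ℂ} (he : ⁅e, w⁆ = 0)
    (hw : ⁅h, w⁆ = m • w + w') (hw' : ⁅h, w'⁆ = m • w') : w' = 0 := by
  by_contra h0
  have hp : t.HasPrimitiveVectorWith w' m := ⟨h0, hw', by
    have : w' = ⁅h, w⁆ - m • w := by rw [hw]; abel
    rw [this, lie_sub, lie_smul, he, leibniz_lie, he, ← lie_skew, t.lie_h_e_nsmul]
    simp [he]⟩
  obtain ⟨n, hn⟩ := hp.exists_nat
  subst hn
  have hh (k : ℕ) : ⁅h, (toEnd ℂ L V f ^ k) w⁆ =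
      ((n : ℂ) - 2 * k) • (toEnd ℂ L V f ^ k) w + (toEnd ℂ L V f ^ k) w' := by
    induction k with
    | zero => simpa using hw
    | succ k ih =>
      rw [pow_succ', Module.End.mul_apply, toEnd_apply_apply, leibniz_lie, t.lie_lie_smul_f ℂ, ih,
        lie_add, lie_smul, neg_lie, smul_lie, Module.End.mul_apply, toEnd_apply_apply]
      push_cast
      module
  have hee (k : ℕ) : ⁅e, (toEnd ℂ L V f ^ (k + 1)) w⁆ =
      ((k + 1 : ℂ) * (n - k)) • (toEnd ℂ L V f ^ k) w + (k + 1 : ℂ) • (toEnd ℂ L V f ^ k) w' := by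
    induction k with
    | zero => simp [leibniz_lie e, t.lie_e_f, he, hw]
    | succ k ih =>
      rw [pow_succ', Module.End.mul_apply, toEnd_apply_apply, leibniz_lie, t.lie_e_f, hh, ih,
        lie_add, lie_smul, lie_smul, pow_succ', Module.End.mul_apply, Module.End.mul_apply,
        toEnd_apply_apply, toEnd_apply_apply]
      push_cast
      module
  have hz (k : ℕ) : (toEnd ℂ L V f ^ (n + 1 + k)) w' = 0 := by
    rw [add_comm, pow_add, Module.End.mul_apply, hp.pow_toEnd_f_eq_zero_of_eq_nat rfl, map_zero]
  have hne (k : ℕ) : (toEnd ℂ L V f ^ (n + 1 + k)) w ≠ 0 := by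
    induction k with
    | zero =>
      intro h1
      have := hee n
      rw [add_zero] at h1
      rw [h1] at this
      simp only [lie_zero, sub_self, mul_zero, zero_smul, zero_add] at this
      exact hp.pow_toEnd_f_ne_zero_of_eq_nat rfl le_rfl
        ((smul_eq_zero.1 this.symm).resolve_left (Nat.cast_add_one_ne_zero _))
    | succ k ih =>
      intro h1
      have := hee (n + 1 + k)
      rw [← add_assoc] at h1
      rw [h1, hz] at this
      simp only [lie_zero, smul_zero, add_zero] at this
      refine ih ((smul_eq_zero.1 this.symm).resolve_left (mul_ne_zero (Nat.cast_add_one_ne_zero _) ?_))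
      push_cast
      have : (n : ℂ) - (n + 1 + k) = -((1 + k : ℕ) : ℂ) := by push_cast; ring
      rw [this, neg_ne_zero, Nat.cast_ne_zero]; lia
  have h3 : ⁅-h, (toEnd ℂ L V f ^ (n + 1)) w⁆ = (n + 2 : ℂ) • (toEnd ℂ L V f ^ (n + 1)) w := by
    have := hz 0
    rw [add_zero] at this
    rw [neg_lie, hh, this]
    push_cast
    module
  obtain ⟨k, hk⟩ := sl2_exists_pow_zero t.symm h3
  apply hne k
  rwa [add_comm, pow_add, Module.End.mul_apply]

noncomputable def sl2Cas (V : Type*) [AddCommGroup V] [Module ℂ V]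
  [LieRingModule L V] [LieModule ℂ L V] (h e f : L) : Module.End ℂ V :=
  toEnd ℂ L V h * toEnd ℂ L V h + (2 : ℂ) • toEnd ℂ L V h + (4 : ℂ) • (toEnd ℂ L V f * toEnd ℂ L V e)

lemma sl2Cas_apply (v : V) : sl2Cas V h e f v = ⁅h, ⁅h, v⁆⁆ + (2 : ℂ) • ⁅h, v⁆ + (4 : ℂ) • ⁅f, ⁅e, v⁆⁆ := by
  simp [sl2Cas]

lemma sl2Cas_h (t : IsSl2Triple h e f) : Commute (sl2Cas V h e f) (toEnd ℂ L V h) := by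
  ext v
  have h1 (x : V) : ⁅h, ⁅e, x⁆⁆ = (2 : ℂ) • ⁅e, x⁆ + ⁅e, ⁅h, x⁆⁆ := by
    rw [leibniz_lie h, t.lie_h_e_smul ℂ, smul_lie]
  have h2 (x : V) : ⁅h, ⁅f, x⁆⁆ = -((2 : ℂ) • ⁅f, x⁆) + ⁅f, ⁅h, x⁆⁆ := by
    rw [leibniz_lie h, t.lie_lie_smul_f ℂ, neg_lie, smul_lie]
  simp only [Module.End.mul_apply, sl2Cas_apply, toEnd_apply_apply, lie_add, lie_smul, h1, h2]
  module

lemma sl2Cas_e (t : IsSl2Triple h e f) : Commute (sl2Cas V h e f) (toEnd ℂ L V e) := by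
  ext v
  have h1 (x : V) : ⁅h, ⁅e, x⁆⁆ = (2 : ℂ) • ⁅e, x⁆ + ⁅e, ⁅h, x⁆⁆ := by
    rw [leibniz_lie h, t.lie_h_e_smul ℂ, smul_lie]
  have h2 (x : V) : ⁅e, ⁅f, x⁆⁆ = ⁅h, x⁆ + ⁅f, ⁅e, x⁆⁆ := by
    rw [leibniz_lie e, t.lie_e_f]
  simp only [Module.End.mul_apply, sl2Cas_apply, toEnd_apply_apply, lie_add, lie_smul, h1, h2]
  module

end Sl2
section Sl2S
open LieModule
variable {L V : Type*} [LieRing L] [LieAlgebra ℂ L] [AddCommGroup V] [Module ℂ V]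
  [LieRingModule L V] [LieModule ℂ L V] [FiniteDimensional ℂ V] {h e f : L}

lemma sl2Cas_prim (t : IsSl2Triple h e f) {w : V} {m : ℂ} (hp : t.HasPrimitiveVectorWith w m)
    {c : ℂ} {N : ℕ} (hN : ((sl2Cas V h e f - algebraMap ℂ _ c) ^ N) w = 0) : c = m ^ 2 + 2 * m := by
  have h1 : (sl2Cas V h e f - algebraMap ℂ _ c) w = (m ^ 2 + 2 * m - c) • w := by
    rw [LinearMap.sub_apply, sl2Cas_apply, hp.lie_h, lie_smul, hp.lie_h, hp.lie_e]
    simp [Module.algebraMap_end_apply]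
    module
  have h2 (k : ℕ) : ((sl2Cas V h e f - algebraMap ℂ _ c) ^ k) w = (m ^ 2 + 2 * m - c) ^ k • w := by
    induction k with
    | zero => simp
    | succ k ih => rw [pow_succ', Module.End.mul_apply, ih, map_smul, h1, smul_smul, ← pow_succ]
  rw [h2] at hN
  have h3 := (smul_eq_zero.1 hN).resolve_right hp.ne_zero
  have h4 := eq_zero_of_pow_eq_zero h3
  linear_combination -h4

lemma nat_quad_ne {i j : ℕ}
    (h6 : (2 * i) ^ 2 + 2 * (2 * i) = (2 * (i + 1) + 2 * j) ^ 2 + 2 * (2 * (i + 1) + 2 * j)) :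
    False := by
  have h1 : 2 * i < 2 * (i + 1) + 2 * j := by lia
  have h2 := Nat.pow_lt_pow_left h1 (n := 2) (by norm_num)
  lia

lemma sl2_ker_sq_aux0 (t : IsSl2Triple h e f) {v : V} (hv : ⁅h, ⁅h, v⁆⁆ = 0) {c : ℂ}
    (T : Module.End ℂ V) (hc1 : Commute T (toEnd ℂ L V h)) (hc2 : Commute T (toEnd ℂ L V e))
    (hT : ∀ (w : V) (m : ℂ), t.HasPrimitiveVectorWith w m → T w = 0 → c = m ^ 2 + 2 * m)
    (hN : T v = 0) : ⁅h, v⁆ = 0 := by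
  by_contra h0
  have hNu : T ⁅h, v⁆ = 0 := by
    have := LinearMap.congr_fun hc1 v
    simp only [Module.End.mul_apply, hN, toEnd_apply_apply, lie_zero] at this
    exact this
  have hNe (w : V) (hw : T w = 0) (k : ℕ) : T ((toEnd ℂ L V e ^ k) w) = 0 := by
    have := LinearMap.congr_fun (hc2.pow_right k) w
    simp only [Module.End.mul_apply, hw, map_zero] at this
    exact this
  obtain ⟨i, hi⟩ := sl2_exists_top (V := V) t (μ := 0) (by simpa using hv) h0
  have hci := hT _ _ hi (hNe _ hNu i)
  have hh (k : ℕ) : ⁅h, (toEnd ℂ L V e ^ k) v⁆ =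
      (2 * k : ℂ) • (toEnd ℂ L V e ^ k) v + (toEnd ℂ L V e ^ k) ⁅h, v⁆ := by
    induction k with
    | zero => simp
    | succ k ih =>
      rw [pow_succ', Module.End.mul_apply, toEnd_apply_apply, leibniz_lie, t.lie_h_e_smul ℂ, ih,
        lie_add, lie_smul, smul_lie, Module.End.mul_apply, toEnd_apply_apply]
      push_cast
      module
  have hz : (toEnd ℂ L V e ^ (i + 1)) ⁅h, v⁆ = 0 := by
    rw [pow_succ', Module.End.mul_apply]; exact hi.lie_e
  by_cases hw : (toEnd ℂ L V e ^ (i + 1)) v = 0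
  · refine hi.ne_zero (sl2_ss1 t (w := (toEnd ℂ L V e ^ i) v) (m := 2 * i) ?_ (hh i) ?_)
    · rw [pow_succ', Module.End.mul_apply] at hw; exact hw
    · have := hi.lie_h
      rwa [zero_add] at this
  · have h5 := hh (i + 1)
    rw [hz, add_zero] at h5
    obtain ⟨j, hj⟩ := sl2_exists_top (V := V) t h5 hw
    have hcj := hT _ _ hj (hNe _ (hNe _ hN (i + 1)) j)
    rw [hci] at hcj
    refine nat_quad_ne (i := i) (j := j) ?_
    rw [zero_add] at hcj
    exact_mod_cast hcj

lemma sl2_comm_pow (T X : Module.End ℂ V) (hT : Commute T X) (c : ℂ) (N : ℕ) :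
    Commute ((T - algebraMap ℂ _ c) ^ N) X :=
  (Commute.sub_left hT (Algebra.commute_algebraMap_left c X)).pow_left N

lemma sl2_ker_sq_aux (t : IsSl2Triple h e f) {v : V} (hv : ⁅h, ⁅h, v⁆⁆ = 0) {c : ℂ} {N : ℕ}
    (hN : ((sl2Cas V h e f - algebraMap ℂ _ c) ^ N) v = 0) : ⁅h, v⁆ = 0 := by
  refine sl2_ker_sq_aux0 t hv ((sl2Cas V h e f - algebraMap ℂ _ c) ^ N) (c := c) ?_ ?_ ?_ hN
  · exact sl2_comm_pow _ _ (sl2Cas_h t) c N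
  · exact sl2_comm_pow _ _ (sl2Cas_e t) c N
  · intro w m hp hN
    exact sl2Cas_prim t hp hN

lemma sl2_ker_sq (t : IsSl2Triple h e f) {v : V} (hv : ⁅h, ⁅h, v⁆⁆ = 0) : ⁅h, v⁆ = 0 := by
  let K : Submodule ℂ V := LinearMap.ker (toEnd ℂ L V h * toEnd ℂ L V h)
  have hK : ∀ x ∈ K, sl2Cas V h e f x ∈ K := by
    intro x hx
    rw [LinearMap.mem_ker] at hx ⊢
    have := LinearMap.congr_fun ((sl2Cas_h (V := V) t).mul_right (sl2Cas_h t)) x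
    rw [Module.End.mul_apply, hx, map_zero] at this
    exact this.symm
  have hle : ⊤ ≤ LinearMap.ker (toEnd ℂ L V h ∘ₗ K.subtype) := by
    rw [← Module.End.iSup_maxGenEigenspace_eq_top ((sl2Cas V h e f).restrict hK), iSup_le_iff]
    intro c x hx
    rw [Module.End.mem_maxGenEigenspace] at hx
    obtain ⟨N, hN⟩ := hx
    rw [LinearMap.mem_ker]
    refine sl2_ker_sq_aux t (v := (x : V)) (by have := x.2; rw [LinearMap.mem_ker] at this; exact this) (c := c) (N := N) ?_
    have h7 (k : ℕ) (y : K) : (((sl2Cas V h e f).restrict hK - c • 1) ^ k) y = 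
      ((sl2Cas V h e f - algebraMap ℂ _ c) ^ k) (y : V) := by
      induction k generalizing y with
      | zero => simp
      | succ k ih =>
        rw [pow_succ, Module.End.mul_apply, ih, pow_succ, Module.End.mul_apply]
        simp [Module.algebraMap_end_apply]
    rw [← h7, hN]; rfl
  have := hle (x := ⟨v, by rw [LinearMap.mem_ker]; exact hv⟩) trivial
  simpa using this
end Sl2S
section Cartan
variable {L : Type*} [LieRing L] [LieAlgebra ℂ L] [FiniteDimensional ℂ L]

def famCent {ι : Type*} (h : ι → L) : LieSubalgebra ℂ L where
  carrier := {x | ∀ i, ⁅h i, x⁆ = 0}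
  add_mem' := fun ha hb i => by rw [lie_add, ha i, hb i, add_zero]
  zero_mem' := fun i => by rw [lie_zero]
  smul_mem' := fun c x hx i => by rw [lie_smul, hx i, smul_zero]
  lie_mem' := fun {x y} hx hy i => by rw [leibniz_lie, hx i, hy i, zero_lie, lie_zero, add_zero]

lemma exists_cartan_of_family {ι : Type*} (h : ι → L) (hc : ∀ i j, ⁅h i, h j⁆ = 0)
    (hs : ∀ i (x : L), ⁅h i, ⁅h i, x⁆⁆ = 0 → ⁅h i, x⁆ = 0) :
    ∃ H : LieSubalgebra ℂ L, H.IsCartanSubalgebra ∧ ∀ i, h i ∈ H := by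
  obtain ⟨z, hz⟩ := LieAlgebra.exists_isCartanSubalgebra_engel ℂ (famCent h)
  have hzn := hz.self_normalizing
  set H0 := LieSubalgebra.engel ℂ z with hH0
  have hmemC (i) : h i ∈ famCent h := fun j => hc j i
  have hmem0 (i) : (⟨h i, hmemC i⟩ : famCent h) ∈ H0 := by
    rw [← hzn, LieSubalgebra.mem_normalizer_iff]
    intro y _
    have : ⁅(⟨h i, hmemC i⟩ : famCent h), y⁆ = 0 := Subtype.ext (y.2 i)
    rw [this]; exact H0.zero_mem
  let H : LieSubalgebra ℂ L := H0.map (famCent h).incl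
  have hmem (i) : h i ∈ H := ⟨_, hmem0 i, rfl⟩
  refine ⟨H, ⟨?_, ?_⟩, hmem⟩
  · have h1 : LieRing.IsNilpotent H0 := hz.nilpotent
    have h2 := LieHom.isNilpotent_range ((famCent h).incl.comp H0.incl)
    have h3 : ((famCent h).incl.comp H0.incl).range = H := by
      ext x; constructor
      · rintro ⟨y, rfl⟩; exact ⟨y.1, y.2, rfl⟩
      · rintro ⟨y, hy, rfl⟩; exact ⟨⟨y, hy⟩, rfl⟩
    rwa [h3] at h2
  · refine le_antisymm ?_ (LieSubalgebra.le_normalizer H)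
    intro x hx
    rw [LieSubalgebra.mem_normalizer_iff'] at hx
    have hxC : x ∈ famCent h := by
      intro i
      apply hs
      obtain ⟨y, _, hy2⟩ := hx _ (hmem i)
      rw [← hy2]
      exact y.2 i
    refine ⟨⟨x, hxC⟩, ?_, rfl⟩
    show _ ∈ H0
    rw [← hzn, LieSubalgebra.mem_normalizer_iff']
    intro y hy
    obtain ⟨y', h1, h2⟩ := hx _ ⟨y, hy, rfl⟩
    have : y' = ⁅y, ⟨x, hxC⟩⁆ := Subtype.ext h2
    rw [← this]; exact h1
end Cartan
section Cascade
open LieModule LieAlgebra LieAlgebra.IsKilling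
variable {L : Type*} [LieRing L] [LieAlgebra ℂ L] [FiniteDimensional ℂ L] [IsKilling ℂ L]
  {H : LieSubalgebra ℂ L} [H.IsCartanSubalgebra]

lemma rt_orth_symm {α β : Weight ℂ H L} (hα : α.IsNonZero) (hβ : β.IsNonZero)
    (h : α (coroot β) = 0) : β (coroot α) = 0 := by
  have := (rootSystem H).pairing_eq_zero_iff (i := ⟨α, by simpa using hα⟩) (j := ⟨β, by simpa using hβ⟩)
  simpa using this.1 (by simpa using h)

lemma rt_int (α β : Weight ℂ H L) : ∃ z : ℤ, α (coroot β) = z :=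
  ⟨_, apply_coroot_eq_cast β α⟩

lemma rt_refl_apply (β α : Weight ℂ H L) (x : H) :
    reflectRoot β α x = α x - α (coroot β) * β x := by
  simp [reflectRoot]

lemma rt_refl_set (Ψ : Finset (Weight ℂ H L))
    (hr : ∀ α ∈ Ψ, ∀ β ∈ Ψ, reflectRoot β α ∈ Ψ) (B : Finset (Weight ℂ H L)) (hB : B ⊆ Ψ)
    (ho : ∀ β ∈ B, ∀ β' ∈ B, β ≠ β' → β (coroot β') = 0) (α : Weight ℂ H L) (hα : α ∈ Ψ) :
    ∃ γ ∈ Ψ, ∀ x, γ x = α x - ∑ b ∈ B, α (coroot b) * b x := by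
  classical
  induction B using Finset.induction_on with
  | empty => exact ⟨α, hα, by simp⟩
  | insert β B hβ ih =>
    obtain ⟨γ, hγ, h1⟩ := ih (fun b hb => hB (Finset.mem_insert_of_mem hb))
      (fun b hb b' hb' => ho b (Finset.mem_insert_of_mem hb) b' (Finset.mem_insert_of_mem hb'))
    refine ⟨reflectRoot β γ, hr _ hγ _ (hB (Finset.mem_insert_self _ _)), fun x => ?_⟩
    have h2 : γ (coroot β) = α (coroot β) := by
      rw [h1, Finset.sum_eq_zero, sub_zero]
      intro b hb
      rw [ho b (Finset.mem_insert_of_mem hb) β (Finset.mem_insert_self _ _)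
        (fun h => hβ (h ▸ hb)), mul_zero]
    rw [rt_refl_apply, h2, h1, Finset.sum_insert hβ]
    ring

lemma rt_cascade (δ : H) (hδ : ∀ α : Weight ℂ H L, α.IsNonZero → (α δ).re ≠ 0) (N : ℕ) :
    ∀ Ψ : Finset (Weight ℂ H L), Ψ.card ≤ N → (∀ α ∈ Ψ, α.IsNonZero) →
    (∀ α ∈ Ψ, ∀ β ∈ Ψ, reflectRoot β α ∈ Ψ) →
    (∀ α ∈ Ψ, ∀ β ∈ Ψ, ∀ γ : Weight ℂ H L, γ.IsNonZero → (∀ x, γ x = α x + β x) → γ ∈ Ψ) →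
    ∃ B ⊆ Ψ, (∀ β ∈ B, 0 < (β δ).re) ∧
      (∀ β ∈ B, ∀ β' ∈ B, β ≠ β' → β (coroot β') = 0) ∧
      (∀ β ∈ B, ∀ β' ∈ B, β ≠ β' → ∀ γ : Weight ℂ H L, ¬ ∀ x, γ x = β x + β' x) ∧
      (∀ α ∈ Ψ, 0 < (α δ).re → ∀ γ ∈ Ψ, (∀ x, γ x = α x - ∑ b ∈ B, α (coroot b) * b x) →
        (γ δ).re < 0) := by
  classical
  induction N with
  | zero =>
    intro Ψ hc _ _ _
    have : Ψ = ∅ := by simpa using hc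
    subst this
    exact ⟨∅, by simp⟩
  | succ N IH =>
    intro Ψ hc hn hr hs
    rcases Ψ.eq_empty_or_nonempty with rfl | hne
    · exact ⟨∅, by simp⟩
    obtain ⟨β, hβ, hmax⟩ := Ψ.exists_max_image (fun α => (α δ).re) hne
    have hβn := hn β hβ
    have hβ2 := root_apply_coroot hβn
    have hpβ : 0 < (β δ).re := by
      have h1 := hmax _ (hr _ hβ _ hβ)
      rw [rt_refl_apply, hβ2] at h1
      have h2 := hδ β hβn
      simp at h1
      rcases lt_or_gt_of_ne h2 with h | h
      · linarith
      · exact h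
    have hclaim (α) (hα : α ∈ Ψ) (z : ℤ) (hz : α (coroot β) = z) (hp : 0 < (α δ).re) : 0 ≤ z := by
      by_contra hlt
      have h1 := hmax _ (hr _ hα _ hβ)
      rw [rt_refl_apply, hz] at h1
      simp at h1
      have : (z : ℝ) ≤ -1 := by exact_mod_cast (show z ≤ -1 by lia)
      nlinarith
    let Ψ' := Ψ.filter (fun α => α (coroot β) = 0)
    have hβΨ' : β ∉ Ψ' := by simp [Ψ', hβ2]
    have hsub : Ψ' ⊆ Ψ := Finset.filter_subset _ _
    have hmem' (α) (h : α ∈ Ψ) (h0 : α (coroot β) = 0) : α ∈ Ψ' := Finset.mem_filter.2 ⟨h, h0⟩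
    have hval' (α) (h : α ∈ Ψ') : α (coroot β) = 0 := (Finset.mem_filter.1 h).2
    have hcard : Ψ'.card ≤ N := by
      have : Ψ'.card < Ψ.card := Finset.card_lt_card ⟨hsub, fun h => hβΨ' (h hβ)⟩
      lia
    obtain ⟨B, hB, hB0, hB1, hB2, hB3⟩ := IH Ψ' hcard (fun α h => hn α (hsub h))
      (fun α h b hb => hmem' _ (hr _ (hsub h) _ (hsub hb)) (by
        rw [rt_refl_apply, hval' _ h, hval' _ hb]; simp))
      (fun α h b hb γ hγ hx => hmem' _ (hs _ (hsub h) _ (hsub hb) γ hγ hx) (by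
        rw [hx, hval' _ h, hval' _ hb]; simp))
    have hβB : β ∉ B := fun h => hβΨ' (hB h)
    have ho1 (b) (hb : b ∈ B) : b (coroot β) = 0 := hval' _ (hB hb)
    have ho2 (b) (hb : b ∈ B) : β (coroot b) = 0 := 
      rt_orth_symm (hn _ (hsub (hB hb))) hβn (ho1 b hb)
    have hpair : ∀ b ∈ insert β B, ∀ b' ∈ insert β B, b ≠ b' → b (coroot b') = 0 := by
      intro b hb b' hb' hne
      rw [Finset.mem_insert] at hb hb'
      rcases hb with rfl | hb <;> rcases hb' with rfl | hb'
      · exact absurd rfl hne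
      · exact ho2 _ hb'
      · exact ho1 _ hb
      · exact hB1 _ hb _ hb' hne
    have hpos (b) (hb : b ∈ B) (γ : Weight ℂ H L) : ¬ ∀ x, γ x = β x + b x := by
      intro hx
      have hγn : γ.IsNonZero := by
        intro h0
        have h1 := hx (coroot β)
        rw [h0, hβ2, ho1 b hb] at h1
        simp at h1
      have h2 := hmax _ (hs _ hβ _ (hsub (hB hb)) γ hγn hx)
      have h3 := hB0 b hb
      rw [hx, Complex.add_re] at h2
      linarith
    refine ⟨insert β B, Finset.insert_subset hβ (hB.trans hsub), ?_, hpair, ?_, ?_⟩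
    · intro b hb
      rw [Finset.mem_insert] at hb
      rcases hb with rfl | hb
      · exact hpβ
      · exact hB0 _ hb
    · intro b hb b' hb' hne γ hx
      rw [Finset.mem_insert] at hb hb'
      rcases hb with rfl | hb <;> rcases hb' with rfl | hb'
      · exact absurd rfl hne
      · exact hpos _ hb' _ hx
      · exact hpos _ hb γ (fun x => by rw [hx, add_comm])
      · exact hB2 _ hb _ hb' hne _ hx
    · intro α hα hp γ hγ hx
      obtain ⟨z, hz⟩ := rt_int α β
      have hz0 := hclaim α hα z hz hp
      rcases hz0.eq_or_lt with h0 | h0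
      · subst h0
        refine hB3 α (hmem' _ hα (by simpa using hz)) hp γ (hmem' _ hγ ?_) ?_
        · rw [hx, Finset.sum_insert hβB, hz, Finset.sum_eq_zero]
          · simp
          · intro b hb; rw [ho1 b hb, mul_zero]
        · intro x
          rw [hx, Finset.sum_insert hβB, hz]; simp
      · by_contra hcon
        have hp' : 0 < (γ δ).re := lt_of_le_of_ne (not_lt.1 hcon) (hδ γ (hn γ hγ)).symm
        have := hclaim γ hγ (-z) (by
          rw [hx, Finset.sum_insert hβB, hz, Finset.sum_eq_zero, hβ2]
          · push_cast; ring
          · intro b hb; rw [ho1 b hb, mul_zero]) hp'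
        lia
end Cascade
section Mod
open LieModule LieAlgebra LieAlgebra.IsKilling
variable {L : Type*} [LieRing L] [LieAlgebra ℂ L] [FiniteDimensional ℂ L] [IsKilling ℂ L]
  {H : LieSubalgebra ℂ L} [H.IsCartanSubalgebra]
  {M : Type*} [AddCommGroup M] [Module ℂ M] [LieRingModule L M] [LieModule ℂ L M]

lemma rt_span_top (P : Submodule ℂ L) (h0 : ∀ x ∈ H, x ∈ P)
    (h1 : ∀ α : Weight ℂ H L, α.IsNonZero → ∀ x ∈ rootSpace H α, x ∈ P) (x : L) : x ∈ P := by
  have h2 : x ∈ (⊤ : LieSubmodule ℂ H L) := trivial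
  rw [← iSup_genWeightSpace_eq_top' ℂ H L, ← LieSubmodule.mem_toSubmodule,
    LieSubmodule.iSup_toSubmodule] at h2
  refine (iSup_le ?_ : _ ≤ P) h2
  intro α y hy
  by_cases hα : α.IsZero
  · rw [LieSubmodule.mem_toSubmodule, hα] at hy
    have hy' : y ∈ rootSpace H (0 : H → ℂ) := hy
    rw [rootSpace_zero_eq ℂ L H] at hy'
    exact h0 y (by simpa using hy')
  · exact h1 α hα y hy

inductive HwGen (H : LieSubalgebra ℂ L) [H.IsCartanSubalgebra] (δ : H) (v : M) : M → Prop
  | base : HwGen H δ v v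
  | step (γ : Weight ℂ H L) (hγ : (γ δ).re < 0) (f : L) (hf : f ∈ rootSpace H γ) (w : M)
      (hw : HwGen H δ v w) : HwGen H δ v ⁅f, w⁆

lemma hw_span_stable (δ : H) (hδ : ∀ α : Weight ℂ H L, α.IsNonZero → (α δ).re ≠ 0)
    (v : M) (μ : H → ℂ) (hv : ∀ z : H, ⁅(z : L), v⁆ = μ z • v)
    (hk : ∀ γ : Weight ℂ H L, 0 < (γ δ).re → ∀ z ∈ rootSpace H γ, ⁅z, v⁆ = 0)
    (w : M) (hw : HwGen H δ v w) (z : L) : ⁅z, w⁆ ∈ Submodule.span ℂ {w | HwGen H δ v w} := by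
  induction hw generalizing z with
  | base =>
    refine rt_span_top (H := H) ((Submodule.span ℂ {w | HwGen H δ v w}).comap
      ((toEnd ℂ L M : L →ₗ[ℂ] Module.End ℂ M).flip v)) ?_ ?_ z
    · intro x hx
      have := hv ⟨x, hx⟩
      simp only at this
      simp only [Submodule.mem_comap, LinearMap.flip_apply, LieHom.coe_toLinearMap, 
        toEnd_apply_apply, this]
      exact Submodule.smul_mem _ _ (Submodule.subset_span HwGen.base)
    · intro α hα x hx
      simp only [Submodule.mem_comap, LinearMap.flip_apply, LieHom.coe_toLinearMap, 
        toEnd_apply_apply]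
      rcases lt_or_gt_of_ne (hδ α hα) with h | h
      · exact Submodule.subset_span (HwGen.step α h x hx _ HwGen.base)
      · rw [hk α h x hx]; exact Submodule.zero_mem _
  | step γ hγ f hf w hw ih =>
    rw [leibniz_lie]
    refine Submodule.add_mem _ (ih _) ?_
    have : Submodule.span ℂ {w | HwGen H δ v w} ≤
        (Submodule.span ℂ {w | HwGen H δ v w}).comap (toEnd ℂ L M f) := by
      rw [Submodule.span_le]
      intro u hu
      exact Submodule.subset_span (HwGen.step γ hγ f hf u hu)
    exact this (ih z)

lemma hw_bound (δ : H) (hδ : ∀ α : Weight ℂ H L, α.IsNonZero → (α δ).re ≠ 0)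
    (v : M) (μ : H → ℂ) (hv : ∀ z : H, ⁅(z : L), v⁆ = μ z • v)
    (hk : ∀ γ : Weight ℂ H L, 0 < (γ δ).re → ∀ z ∈ rootSpace H γ, ⁅z, v⁆ = 0)
    (y : H) (hy : ∀ γ : Weight ℂ H L, 0 < (γ δ).re → 0 ≤ (γ y).re)
    (u : M) (hu : u ∈ LieSubmodule.lieSpan ℂ L {v}) (hu0 : u ≠ 0) (c : ℂ)
    (hc : ⁅(y : L), u⁆ = c • u) : c.re ≤ (μ y).re := by
  by_contra hlt
  push Not at hlt
  let T : Module.End ℂ M := toEnd ℂ L M (y : L)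
  let N : LieSubmodule ℂ L M :=
    { Submodule.span ℂ {w | HwGen H δ v w} with
      lie_mem := by
        intro z m hm
        have : Submodule.span ℂ {w | HwGen H δ v w} ≤
            (Submodule.span ℂ {w | HwGen H δ v w}).comap (toEnd ℂ L M z) := by
          rw [Submodule.span_le]
          intro u hu
          exact hw_span_stable δ hδ v μ hv hk u hu z
        exact this hm }
  have h1 : LieSubmodule.lieSpan ℂ L {v} ≤ N := by
    rw [LieSubmodule.lieSpan_le]
    rintro _ rfl
    exact Submodule.subset_span HwGen.base
  have h2 (w : M) (hw : HwGen H δ v w) : ∃ d : ℂ, d.re ≤ (μ y).re ∧ ⁅(y : L), w⁆ = d • w := by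
    induction hw with
    | base => exact ⟨μ y, le_rfl, hv y⟩
    | step γ hγ f hf w hw ih =>
      obtain ⟨d, hd1, hd2⟩ := ih
      refine ⟨γ y + d, ?_, ?_⟩
      · have := hy (-γ) (by simpa using hγ)
        simp at this ⊢
        linarith
      · have h3 : ⁅(y : L), f⁆ = γ y • f := lie_eq_smul_of_mem_rootSpace hf y
        rw [leibniz_lie, h3, hd2, smul_lie, lie_smul, add_smul]
  have h3 : Submodule.span ℂ {w | HwGen H δ v w} ≤ ⨆ d, ⨆ (_ : d ≠ c), T.eigenspace d := by
    rw [Submodule.span_le]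
    intro w hw
    obtain ⟨d, hd1, hd2⟩ := h2 w hw
    refine Submodule.mem_iSup_of_mem d (Submodule.mem_iSup_of_mem ?_ ?_)
    · rintro rfl; linarith
    · exact Module.End.mem_eigenspace_iff.2 hd2
  have h4 := (Module.End.eigenspaces_iSupIndep T) c
  rw [Submodule.disjoint_def] at h4
  exact hu0 (h4 u (Module.End.mem_eigenspace_iff.2 hc) (h3 (h1 hu)))
  
lemma sl2_reflect_set [FiniteDimensional ℂ M] {ι κ : Type*} (a : ι → L) (B : Finset κ) (h e f : κ → L)
    (ht : ∀ b ∈ B, IsSl2Triple (h b) (e b) (f b))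
    (β : κ → ι → ℂ) (hae : ∀ b ∈ B, ∀ i, ⁅a i, e b⁆ = β b i • e b)
    (haf : ∀ b ∈ B, ∀ i, ⁅a i, f b⁆ = -β b i • f b)
    (c : κ → ι) (hac : ∀ b ∈ B, a (c b) = h b)
    (ho : ∀ b ∈ B, ∀ b' ∈ B, b ≠ b' → β b (c b') = 0) (ν : ι → ℂ) (v : M) (h0 : v ≠ 0)
    (hv : ∀ i, ⁅a i, v⁆ = ν i • v) :
    ∃ v' : M, v' ≠ 0 ∧ ∀ i, ⁅a i, v'⁆ = (ν i - ∑ b ∈ B, ν (c b) * β b i) • v' := by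
  classical
  induction B using Finset.induction_on with
  | empty => exact ⟨v, h0, by simpa using hv⟩
  | insert b B hb ih =>
    simp only [Finset.forall_mem_insert] at ht hae haf hac ho
    obtain ⟨v', hv0, hv'⟩ := ih ht.2 hae.2 haf.2 hac.2 (fun b hb => (ho.2 b hb).2)
    have h1 : ν (c b) - ∑ b' ∈ B, ν (c b') * β b' (c b) = ν (c b) := by
      rw [Finset.sum_eq_zero, sub_zero]
      intro b' hb'
      rw [(ho.2 b' hb').1 (fun h => hb (h ▸ hb')), mul_zero]
    obtain ⟨v'', hv0', hv''⟩ := sl2_reflect ht.1 a (β b) _ hae.1 haf.1 hv0 hv' (ν (c b)) (by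
      rw [← hac.1, hv', h1])
    refine ⟨v'', hv0', fun i => ?_⟩
    rw [hv'', Finset.sum_insert hb]
    congr 1
    ring

lemma exists_common_eig [FiniteDimensional ℂ M] (x : H) (c : ℂ) (v : M) (h0 : v ≠ 0) (hv : ⁅(x : L), v⁆ = c • v) :
    ∃ (ν : Module.Dual ℂ H) (w : M), w ≠ 0 ∧ (∀ z : H, ⁅(z : L), w⁆ = ν z • w) ∧ ν x = c := by
  let E : LieSubmodule ℂ H M :=
    { Module.End.eigenspace (toEnd ℂ L M (x : L)) c with
      lie_mem := by
        intro z m hm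
        simp only [Submodule.carrier_eq_coe, SetLike.mem_coe, Module.End.mem_eigenspace_iff,
          toEnd_apply_apply] at hm ⊢
        show ⁅(x : L), ⁅(z : L), m⁆⁆ = c • ⁅(z : L), m⁆
        have h1 : ⁅(x : L), (z : L)⁆ = 0 := by
          have : ⁅x, z⁆ = 0 := trivial_lie_zero H H x z
          simpa using congrArg (Subtype.val) this
        rw [leibniz_lie, h1, hm, zero_lie, lie_smul, zero_add] }
  have hvE : v ∈ E := Module.End.mem_eigenspace_iff.2 hv
  haveI : Nontrivial E := ⟨⟨⟨v, hvE⟩, 0, fun h => h0 (congrArg Subtype.val h)⟩⟩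
  obtain ⟨ν, hν⟩ := exists_nontrivial_weightSpace_of_isSolvable ℂ H E
  obtain ⟨⟨w, hw⟩, hw0⟩ := exists_ne (0 : weightSpace E ν)
  rw [mem_weightSpace] at hw
  have hw0' : (w : M) ≠ 0 := fun h => hw0 (Subtype.ext (Subtype.ext h))
  have h2 (z : H) : ⁅(z : L), (w : M)⁆ = ν z • (w : M) := congrArg Subtype.val (hw z)
  refine ⟨ν, w, hw0', h2, ?_⟩
  have h3 : ⁅(x : L), (w : M)⁆ = c • (w : M) := Module.End.mem_eigenspace_iff.1 w.2
  rw [h2 x] at h3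
  exact smul_left_injective ℂ hw0' h3
end Mod
section HW
open LieModule LieAlgebra LieAlgebra.IsKilling
variable {L : Type*} [LieRing L] [LieAlgebra ℂ L] [FiniteDimensional ℂ L] [IsKilling ℂ L]
  {H : LieSubalgebra ℂ L} [H.IsCartanSubalgebra]

lemma rt_vec_indep (e : Weight ℂ H L → L)
    (he : ∀ α : Weight ℂ H L, e α ∈ rootSpace H α) (he0 : ∀ α, e α ≠ 0) :
    LinearIndependent ℂ e := by
  have h1 := iSupIndep_genWeightSpace' ℂ H L
  rw [← LieSubmodule.iSupIndep_toSubmodule] at h1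
  exact h1.linearIndependent _ (fun α => he α) he0

lemma rt_mem_smul (e : Weight ℂ H L → L)
    (he : ∀ α : Weight ℂ H L, e α ∈ rootSpace H α) (he0 : ∀ α, e α ≠ 0) (α : Weight ℂ H L) (hα : α.IsNonZero)
    (x : L) (hx : x ∈ rootSpace H α) : ∃ c : ℂ, x = c • e α := by
  have h1 := finrank_rootSpace_eq_one α hα
  have h2 := (finrank_eq_one_iff_of_nonzero' (⟨e α, he α⟩ : rootSpace H α)
    (fun h => he0 α (congrArg Subtype.val h))).1 h1 ⟨x, hx⟩
  obtain ⟨c, hc⟩ := h2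
  exact ⟨c, (congrArg Subtype.val hc).symm⟩

lemma exists_hw_vec (δ x : H) (a : Weight ℂ H L → ℤ) (ha : ∀ α, α x = a α)
    (hpos : ∀ α : Weight ℂ H L, 0 < (α δ).re → 0 ≤ a α) (k : ℤ) (hk : 1 ≤ k)
    (S : Finset (Weight ℂ H L)) (hS : ∀ α, α ∈ S ↔ k ≤ a α) :
    ∃ v : ExteriorAlgebra ℂ L, v ≠ 0 ∧ (∀ z : H, ⁅(z : L), v⁆ = (∑ α ∈ S, α z) • v) ∧
      ∀ γ : Weight ℂ H L, 0 < (γ δ).re → ∀ z ∈ rootSpace H γ, ⁅z, v⁆ = 0 := by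
  choose e he he0 using fun α : Weight ℂ H L => α.exists_ne_zero
  have hSn (α) (h : k ≤ a α) : α.IsNonZero := by
    intro h0
    have := ha α
    rw [h0] at this
    have : a α = 0 := by
      rw [Pi.zero_apply] at this
      exact_mod_cast this.symm
    lia
  let φ : Fin S.card → Weight ℂ H L := fun i => (S.equivFin.symm i : Weight ℂ H L)
  have hφ : Function.Injective φ := Subtype.val_injective.comp S.equivFin.symm.injective
  have hφS (i) : φ i ∈ S := (S.equivFin.symm i).2
  refine ⟨ExteriorAlgebra.ιMulti ℂ _ (e ∘ φ), ext_ιMulti_ne_zero _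
    ((rt_vec_indep e he he0).comp φ hφ), ?_, ?_⟩
  · intro z
    rw [ext_lie_eig (z : L) (e ∘ φ) (fun i => φ i z) (fun i => lie_eq_smul_of_mem_rootSpace (he _) z)]
    congr 1
    rw [← Finset.sum_coe_sort S, ← S.equivFin.symm.sum_comp]
  · intro γ hγ z hz
    refine ext_lie_kill z _ (fun i => ?_)
    by_cases h0 : ⁅z, e (φ i)⁆ = 0
    · exact Or.inl h0
    right
    have hmem := lie_mem_genWeightSpace_of_mem_genWeightSpace hz (he (φ i))
    have hne : genWeightSpace L (γ + φ i : H → ℂ) ≠ ⊥ := by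
      intro hbot
      rw [hbot] at hmem
      exact h0 (by simpa using hmem)
    let α' : Weight ℂ H L := ⟨γ + φ i, hne⟩
    have hα' (w : H) : α' w = γ w + φ i w := rfl
    have haα' : a α' = a γ + a (φ i) := by
      have := ha α'
      rw [hα', ha, ha] at this
      exact_mod_cast this.symm
    have hkα : k ≤ a α' := by
      have h1 := (hS _).1 (hφS i)
      have h2 := hpos γ hγ
      lia
    have hα'S := (hS α').2 hkα
    obtain ⟨c, hc⟩ := rt_mem_smul e he he0 α' (hSn _ hkα) _ hmem
    refine ⟨S.equivFin ⟨α', hα'S⟩, ?_, c, ?_⟩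
    · intro hji
      have h3 : φ i = α' := by rw [← hji]; simp [φ]
      have h4 := hα' δ
      rw [← h3] at h4
      have : γ δ = 0 := by simpa using h4
      rw [this] at hγ
      simp at hγ
    · simpa [φ] using hc

lemma hw_ineq {n : ℕ} (hh ee ff : Fin n → L) (ht : ∀ i, IsSl2Triple (hh i) (ee i) (ff i))
    (hhe : ∀ i j, i ≠ j → ⁅hh i, ee j⁆ = 0) (hhf : ∀ i j, i ≠ j → ⁅hh i, ff j⁆ = 0)
    (hH : ∀ i, hh i ∈ H) (q : Fin n → ℂ)
    (δ x : H) (hx : (x : L) = ∑ i, q i • hh i)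
    (hδ : ∀ α : Weight ℂ H L, α.IsNonZero → (α δ).re ≠ 0)
    (a : Weight ℂ H L → ℤ) (ha : ∀ α, α x = a α)
    (hpos : ∀ α : Weight ℂ H L, 0 < (α δ).re → 0 ≤ a α) 
    (B : Finset (Weight ℂ H L)) (hBn : ∀ b ∈ B, b.IsNonZero)
    (hBo : ∀ b ∈ B, ∀ b' ∈ B, b ≠ b' → b (coroot b') = 0)
    (y : H) (hy : y = -x + ∑ b ∈ B, b x • coroot b)
    (hyd : ∀ γ : Weight ℂ H L, 0 < (γ δ).re → 0 ≤ (γ y).re)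
    (k : ℤ) (hk : 1 ≤ k)
    (S : Finset (Weight ℂ H L)) (hS : ∀ α, α ∈ S ↔ k ≤ a α) :
    (∑ α ∈ S, α x).re ≤ (∑ α ∈ S, α y).re := by
  classical
  obtain ⟨v, hv0, hv, hvk⟩ := exists_hw_vec δ x a ha hpos k hk S hS
  have hfd : FiniteDimensional ℂ (ExteriorAlgebra ℂ L) := inferInstance
  let V := LieSubmodule.lieSpan ℂ L {v}
  let v1 : V := ⟨v, LieSubmodule.subset_lieSpan rfl⟩
  let μ : Module.Dual ℂ H := ∑ α ∈ S, Weight.toLinear ℂ H L α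
  have hμ (z : H) : μ z = ∑ α ∈ S, α z := by simp [μ]
  have hv1 (i : Fin n) : ⁅hh i, v1⁆ = μ ⟨hh i, hH i⟩ • v1 := by
    apply Subtype.ext
    rw [hμ]
    exact hv ⟨hh i, hH i⟩
  obtain ⟨v2, hv20, hv2⟩ := sl2_reflect_set (M := V) hh Finset.univ hh ee ff (fun i _ => ht i)
    (fun b i => if i = b then 2 else 0)
    (by
      intro b _ i
      split_ifs with hib
      · subst hib; exact (ht i).lie_h_e_smul ℂ
      · rw [hhe i b hib, zero_smul])
    (by
      intro b _ i
      split_ifs with hib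
      · subst hib; rw [(ht i).lie_lie_smul_f ℂ, neg_smul]
      · rw [hhf i b hib]; simp) id (fun _ _ => rfl)
    (by intro b _ b' _ hbb; simp [Ne.symm hbb]) (fun i => μ ⟨hh i, hH i⟩) v1 
    (fun h => hv0 (congrArg Subtype.val h)) hv1
  have hxsum : x = ∑ i, q i • (⟨hh i, hH i⟩ : H) := by
    apply Subtype.ext
    rw [hx]; simp
  have hv2x : ⁅(x : L), v2⁆ = (-μ x) • v2 := by
    have h1 (i) : ⁅hh i, v2⁆ = (- μ ⟨hh i, hH i⟩) • v2 := by
      rw [hv2]; congr 1; simp; ring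
    have h2 : ⁅(x : L), v2⁆ = ∑ i, q i • ⁅hh i, v2⁆ := by
      rw [hx]
      have := map_sum ((toEnd ℂ L V : L →ₗ[ℂ] Module.End ℂ V).flip v2) (fun i => q i • hh i) Finset.univ
      simp only [LinearMap.flip_apply, LieHom.coe_toLinearMap, toEnd_apply_apply, smul_lie] at this
      exact this
    rw [h2, hxsum, map_sum, ← Finset.sum_neg_distrib, Finset.sum_smul]
    refine Finset.sum_congr rfl fun i _ => ?_
    rw [h1, map_smul, smul_smul]; congr 1; simp
  obtain ⟨ν, w, hw0, hw, hνx⟩ := exists_common_eig (M := V) x _ v2 hv20 hv2x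
  have htr (b : Weight ℂ H L) : ∃ h e f : L, b ∈ B → (IsSl2Triple h e f ∧ e ∈ rootSpace H b ∧ f ∈ rootSpace H (-b)) := by
    by_cases hb : b ∈ B
    · obtain ⟨h, e, f, h1⟩ := exists_isSl2Triple_of_weight_isNonZero (hBn b hb)
      exact ⟨h, e, f, fun _ => h1⟩
    · exact ⟨0, 0, 0, fun h => absurd h hb⟩
  choose h e f hef using htr
  obtain ⟨w', hw'0, hw'⟩ := sl2_reflect_set (M := V) (fun z : H => (z : L)) B h e f (fun b hb => (hef b hb).1)
    (fun b z => b z) (fun b hb z => lie_eq_smul_of_mem_rootSpace (hef b hb).2.1 z)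
    (fun b hb z => lie_eq_smul_of_mem_rootSpace (hef b hb).2.2 z) (fun b => coroot b)
    (fun b hb => ((hef b hb).1.h_eq_coroot (hBn b hb) (hef b hb).2.1 (hef b hb).2.2).symm)
    hBo (fun z => ν z) w hw0 hw
  have hby (b) (hb : b ∈ B) : b y = b x := by
    have h1 : b y = Weight.toLinear ℂ H L b y := rfl
    rw [h1, hy, map_add, map_neg, map_sum, Finset.sum_eq_single b]
    · simp [root_apply_coroot (hBn b hb)]; ring
    · intro b' hb' hne
      simp [hBo b hb b' hb' hne.symm]
    · exact fun h => absurd hb h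
  have hfin : ν y - ∑ b ∈ B, ν (coroot b) * b y = μ x := by
    have h1 : ∑ b ∈ B, ν (coroot b) * b y = ∑ b ∈ B, b x * ν (coroot b) :=
      Finset.sum_congr rfl fun b hb => by rw [hby b hb, mul_comm]
    rw [h1, hy, map_add, map_neg, map_sum, hνx]
    simp
  have := hw_bound (M := ExteriorAlgebra ℂ L) δ hδ v (fun z => ∑ α ∈ S, α z) hv hvk y hyd
    (w' : ExteriorAlgebra ℂ L) w'.2 (fun h => hw'0 (Subtype.ext h)) (μ x) (by
      rw [← hfin]; exact congrArg Subtype.val (hw' y))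
  rwa [hμ] at this
end HW
section EQ
open LieModule LieAlgebra LieAlgebra.IsKilling

lemma layer_cake {ι : Type*} [Fintype ι] (a : ι → ℤ) (r : ι → ℝ)
    (h : ∀ k : ℤ, 1 ≤ k → ∀ S : Finset ι, (∀ i, i ∈ S ↔ k ≤ a i) →
      ∑ i ∈ S, (a i : ℝ) ≤ ∑ i ∈ S, r i) :
    ∑ i, ((a i).toNat : ℝ) * a i ≤ ∑ i, ((a i).toNat : ℝ) * r i := by
  classical
  obtain ⟨N, hN⟩ : ∃ N : ℕ, ∀ i, (a i).toNat ≤ N :=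
    ⟨∑ i, (a i).toNat, fun i => Finset.single_le_sum (f := fun i => (a i).toNat)
      (fun _ _ => Nat.zero_le _) (Finset.mem_univ i)⟩
  have key (g : ι → ℝ) : ∑ i, ((a i).toNat : ℝ) * g i =
      ∑ k ∈ Finset.range N, ∑ i ∈ Finset.univ.filter (fun i => ((k : ℤ) + 1) ≤ a i), g i := by
    simp_rw [Finset.sum_filter]
    rw [Finset.sum_comm]
    refine Finset.sum_congr rfl fun i _ => ?_
    rw [← Finset.sum_filter, Finset.sum_const, nsmul_eq_mul]
    congr 2
    have : Finset.filter (fun k : ℕ => (k : ℤ) + 1 ≤ a i) (Finset.range N) =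
        Finset.range (a i).toNat := by
      ext k
      have := hN i
      simp only [Finset.mem_filter, Finset.mem_range]
      lia
    rw [this, Finset.card_range]
  rw [key, key]
  refine Finset.sum_le_sum fun k _ => h (k + 1) (by lia) _ (by simp)

lemma sq_eq_of {ι : Type*} [Fintype ι] (a : ι → ℤ) (r : ι → ℝ) (neg : ι → ι)
    (hneg : Function.Involutive neg) (han : ∀ i, a (neg i) = - a i) (hrn : ∀ i, r (neg i) = - r i)
    (hsq : ∑ i, r i ^ 2 = ∑ i, (a i : ℝ) ^ 2)
    (h : ∑ i, ((a i).toNat : ℝ) * a i ≤ ∑ i, ((a i).toNat : ℝ) * r i) (i : ι) : (a i : ℝ) = r i := by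
  have key (g : ι → ℝ) (hg : ∀ i, g (neg i) = - g i) :
      ∑ i, (a i : ℝ) * g i = 2 * ∑ i, ((a i).toNat : ℝ) * g i := by
    have h1 : ∑ i, (a i : ℝ) * g i = ∑ i, ((a i).toNat : ℝ) * g i - ∑ i, ((-a i).toNat : ℝ) * g i := by
      rw [← Finset.sum_sub_distrib]
      refine Finset.sum_congr rfl fun i _ => ?_
      rw [← sub_mul]
      congr 1
      have : a i = ((a i).toNat : ℤ) - ((-a i).toNat : ℤ) := by lia
      exact_mod_cast this
    have h2 : ∑ i, ((-a i).toNat : ℝ) * g i = - ∑ i, ((a i).toNat : ℝ) * g i := by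
      rw [← Equiv.sum_comp hneg.toPerm, ← Finset.sum_neg_distrib]
      refine Finset.sum_congr rfl fun i _ => ?_
      simp [han, hg]
    rw [h1, h2]; ring
  have h1 : ∑ i, (a i : ℝ) * a i ≤ ∑ i, (a i : ℝ) * r i := by
    rw [key _ (fun i => by rw [han]; push_cast; rfl), key _ hrn]; linarith
  have h2 : ∑ i, ((a i : ℝ) - r i) ^ 2 ≤ 0 := by
    have : ∑ i, ((a i : ℝ) - r i) ^ 2 = ∑ i, (a i : ℝ) ^ 2 + ∑ i, r i ^ 2 - 2 * ∑ i, (a i : ℝ) * r i := by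
      rw [Finset.mul_sum, ← Finset.sum_add_distrib, ← Finset.sum_sub_distrib]
      exact Finset.sum_congr rfl fun i _ => by ring
    rw [this, hsq]
    have h3 : ∑ i, (a i : ℝ) ^ 2 = ∑ i, (a i : ℝ) * a i := Finset.sum_congr rfl fun i _ => by ring
    linarith
  have h3 := (Finset.sum_eq_zero_iff_of_nonneg (fun i _ => sq_nonneg _)).1
    (le_antisymm h2 (Finset.sum_nonneg fun i _ => sq_nonneg _)) i (Finset.mem_univ i)
  exact sub_eq_zero.1 (pow_eq_zero_iff (two_ne_zero) |>.1 h3)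

variable {L : Type*} [LieRing L] [LieAlgebra ℂ L] [FiniteDimensional ℂ L] [IsKilling ℂ L]
  {H : LieSubalgebra ℂ L} [H.IsCartanSubalgebra]

lemma hw_mem_span {n : ℕ} (hh ee ff : Fin n → L) (ht : ∀ i, IsSl2Triple (hh i) (ee i) (ff i))
    (hhe : ∀ i j, i ≠ j → ⁅hh i, ee j⁆ = 0) (hhf : ∀ i j, i ≠ j → ⁅hh i, ff j⁆ = 0)
    (hH : ∀ i, hh i ∈ H) (q : Fin n → ℂ)
    (δ x : H) (hx : (x : L) = ∑ i, q i • hh i)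
    (hδ : ∀ α : Weight ℂ H L, α.IsNonZero → (α δ).re ≠ 0)
    (a : Weight ℂ H L → ℤ) (ha : ∀ α : Weight ℂ H L, α x = a α)
    (hpos : ∀ α : Weight ℂ H L, 0 < (α δ).re → 0 ≤ a α) 
    (B : Finset (Weight ℂ H L)) (hBn : ∀ b ∈ B, b.IsNonZero)
    (hBo : ∀ b ∈ B, ∀ b' ∈ B, b ≠ b' → b (coroot b') = 0)
    (hBw : ∀ α : Weight ℂ H L, 0 < (α δ).re → ∀ γ : Weight ℂ H L,
      (∀ x, γ x = α x - ∑ b ∈ B, α (coroot b) * b x) → (γ δ).re < 0) :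
    x ∈ Submodule.span ℂ (coroot '' (B : Set (Weight ℂ H L))) := by
  classical
  haveI : Fintype (Weight ℂ H L) := Fintype.ofFinite _
  have hw (α : Weight ℂ H L) : ∃ γ : Weight ℂ H L, ∀ x, γ x = α x - ∑ b ∈ B, α (coroot b) * b x := by
    obtain ⟨γ, -, h⟩ := rt_refl_set Finset.univ (by simp) B (by simp) hBo α (by simp)
    exact ⟨γ, h⟩
  choose w hw using hw
  have hwc (α) (b) (hb : b ∈ B) : w α (coroot b) = - α (coroot b) := by
    rw [hw, Finset.sum_eq_single b]
    · rw [root_apply_coroot (hBn b hb)]; ring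
    · intro b' hb' hne; rw [hBo b' hb' b hb hne, mul_zero]
    · exact fun h => absurd hb h
  have hwinv : Function.Involutive w := by
    intro α
    ext z
    rw [hw, hw α z]
    have : ∑ b ∈ B, w α (coroot b) * b z = - ∑ b ∈ B, α (coroot b) * b z := by
      rw [← Finset.sum_neg_distrib]
      exact Finset.sum_congr rfl fun b hb => by rw [hwc α b hb]; ring
    rw [this]; ring
  obtain ⟨y, hy⟩ : ∃ y, y = -x + ∑ b ∈ B, b x • coroot b := ⟨_, rfl⟩
  have hwy (α : Weight ℂ H L) : α y = - (a (w α) : ℂ) := by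
    have h1 : α y = Weight.toLinear ℂ H L α y := rfl
    rw [← ha, hw, h1, hy, map_add, map_neg, map_sum]
    simp [mul_comm]
    ring
  have han (α : Weight ℂ H L) : a (-α) = - a α := by
    have := ha (-α)
    rw [Weight.coe_neg, Pi.neg_apply, ha] at this
    exact_mod_cast this.symm
  have hyd (γ : Weight ℂ H L) (hγ : 0 < (γ δ).re) : 0 ≤ (γ y).re := by
    have h1 := hBw γ hγ (w γ) (hw γ)
    have h2 := hpos (-w γ) (by simpa using h1)
    rw [han] at h2
    rw [hwy]
    have h3 : (0 : ℝ) ≤ ((-a (w γ) : ℤ) : ℝ) := by exact_mod_cast h2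
    simpa using h3
  have hlc := layer_cake a (fun α => (α y).re) (by
    intro k hk S hS
    have := hw_ineq hh ee ff ht hhe hhf hH q δ x hx hδ a ha hpos B hBn hBo y hy hyd k hk S hS
    simp only [Complex.re_sum, ha] at this
    simpa using this)
  have heq (α : Weight ℂ H L) : (a α : ℝ) = (α y).re := by
    refine sq_eq_of a (fun α => (α y).re) (fun α => -α) neg_involutive han (by simp) ?_ hlc α
    rw [← Equiv.sum_comp hwinv.toPerm]
    refine Finset.sum_congr rfl fun β _ => ?_
    simp [hwy, hwinv β]
  have hxy : x = y := by
    rw [← sub_eq_zero]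
    have : x - y ∈ (⨅ α : Weight ℂ H L, α.ker) := by
      rw [Submodule.mem_iInf]
      intro α
      show Weight.toLinear ℂ H L α (x - y) = 0
      rw [map_sub]
      show α x - α y = 0
      have h1 := heq α
      rw [hwy] at h1 ⊢
      rw [ha]
      simp at h1
      have : a α = - a (w α) := by exact_mod_cast h1
      rw [this]; simp
    rwa [iInf_ker_weight_eq_bot] at this
  have h2x : x = (2⁻¹ : ℂ) • ∑ b ∈ B, b x • coroot b := by
    have : (2 : ℂ) • x = ∑ b ∈ B, b x • coroot b := by
      rw [two_smul]; nth_rewrite 2 [hxy]; rw [hy]; abel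
    rw [← this, smul_smul]; norm_num
  rw [h2x]
  exact Submodule.smul_mem _ _ (Submodule.sum_mem _ fun b hb => Submodule.smul_mem _ _
    (Submodule.subset_span ⟨b, hb, rfl⟩))
end EQ
section Gen
open LieModule LieAlgebra LieAlgebra.IsKilling

lemma generic_vec {V : Type*} [AddCommGroup V] [Module ℂ V] {n : ℕ} (v : Fin n → V)
    (Ss : Set (Submodule ℂ V)) (hS : Ss.Finite) :
    ∃ N : ℕ, ∀ W ∈ Ss, ∑ i : Fin n, (N : ℂ) ^ (i : ℕ) • v i ∈ W → ∀ i, v i ∈ W := by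
  have key (W : Submodule ℂ V) :
      {N : ℕ | ¬ (∑ i : Fin n, (N : ℂ) ^ (i : ℕ) • v i ∈ W → ∀ i, v i ∈ W)}.Finite := by
    by_cases hv : ∀ i, v i ∈ W
    · simp [hv]
    push Not at hv
    obtain ⟨j, hj⟩ := hv
    obtain ⟨φ, h1, h2⟩ := Submodule.exists_le_ker_of_notMem hj
    let p : Polynomial ℂ := ∑ i : Fin n, Polynomial.C (φ (v i)) * Polynomial.X ^ (i : ℕ)
    have hp : p ≠ 0 := by
      intro h
      have := congrArg (fun q => Polynomial.coeff q (j : ℕ)) h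
      simp only [p, Polynomial.finset_sum_coeff, Polynomial.coeff_C_mul_X_pow,
        Polynomial.coeff_zero] at this
      rw [Finset.sum_eq_single j] at this
      · simp at this; exact h1 this
      · intro b _ hb
        rw [if_neg]
        intro h; exact hb (Fin.ext h.symm)
      · simp
    refine Set.Finite.subset (Set.Finite.preimage (f := fun N : ℕ => (N : ℂ))
      (Nat.cast_injective.injOn) (Polynomial.finite_setOf_isRoot hp)) ?_
    intro N hN
    simp only [Set.mem_setOf_eq, Classical.not_imp] at hN
    have := h2 hN.1
    simp only [Set.mem_preimage, Set.mem_setOf_eq, Polynomial.IsRoot, p]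
    rw [LinearMap.mem_ker] at this
    simp only [map_sum, map_smul, smul_eq_mul] at this
    simp only [Polynomial.eval_finset_sum, Polynomial.eval_mul, Polynomial.eval_C,
      Polynomial.eval_pow, Polynomial.eval_X]
    rw [← this]
    exact Finset.sum_congr rfl fun i _ => mul_comm _ _
  have hfin := hS.biUnion (fun W _ => key W)
  obtain ⟨N, hN⟩ := hfin.infinite_compl.nonempty
  refine ⟨N, fun W hW => ?_⟩
  by_contra hc
  exact hN (Set.mem_biUnion hW hc)

variable {L : Type*} [LieRing L] [LieAlgebra ℂ L] [FiniteDimensional ℂ L] [IsKilling ℂ L]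
  {H : LieSubalgebra ℂ L} [H.IsCartanSubalgebra]

lemma exists_regular_re : ∃ δ : H, ∀ α : Weight ℂ H L, α.IsNonZero → (α δ).re ≠ 0 := by
  have := Module.Dual.exists_forall_ne_zero_of_forall_exists (K := ℝ) (M := H)
    (ι := {α : Weight ℂ H L // α.IsNonZero})
    (fun α => Complex.reLm ∘ₗ (Weight.toLinear ℂ H L α.1).restrictScalars ℝ) ?_
  · obtain ⟨δ, hδ⟩ := this
    exact ⟨δ, fun α hα => by simpa using hδ ⟨α, hα⟩⟩
  · rintro ⟨α, hα⟩
    obtain ⟨x, hx⟩ : ∃ x, α x ≠ 0 := by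
      by_contra! h
      exact hα (funext h)
    by_cases h : (α x).re = 0
    · refine ⟨Complex.I • x, ?_⟩
      have : (α x).im ≠ 0 := fun h' => hx (Complex.ext h h')
      have e : α (Complex.I • x) = Complex.I * α x := (Weight.toLinear ℂ H L α).map_smul _ _
      simp [e, this]
    · exact ⟨x, by simpa using h⟩

lemma rt_orth_span (a : Weight ℂ H L → ℤ) (x : H) (ha : ∀ α : Weight ℂ H L, α x = a α) :
    ∃ δ : H, (∀ α : Weight ℂ H L, α.IsNonZero → (α δ).re ≠ 0) ∧
      (∀ α : Weight ℂ H L, 0 < (α δ).re → 0 ≤ a α) := by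
  classical
  haveI : Fintype (Weight ℂ H L) := Fintype.ofFinite _
  obtain ⟨δ, hδ⟩ := exists_regular_re (L := L) (H := H)
  let M : ℝ := 1 + ∑ α : Weight ℂ H L, |(α δ).re|
  have hM (α : Weight ℂ H L) : |(α δ).re| < M := by
    have := Finset.single_le_sum (f := fun α : Weight ℂ H L => |(α δ).re|)
      (fun _ _ => abs_nonneg _) (Finset.mem_univ α)
    simp only [M]; linarith
  have hM0 : 0 < M := by
    have := Finset.sum_nonneg (s := Finset.univ) (f := fun α : Weight ℂ H L => |(α δ).re|)
      (fun _ _ => abs_nonneg _)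
    simp only [M]; linarith
  have e (α : Weight ℂ H L) : (α ((M : ℂ) • x + δ)).re = M * a α + (α δ).re := by
    have : α ((M : ℂ) • x + δ) = M * α x + α δ := by
      have := (Weight.toLinear ℂ H L α).map_add ((M : ℂ) • x) δ
      rw [map_smul] at this
      exact this
    rw [this, ha]; simp
  have p1 (α : Weight ℂ H L) (h : a α < 0) : (α ((M : ℂ) • x + δ)).re < 0 := by
    rw [e]
    have h1 : (a α : ℝ) ≤ -1 := by exact_mod_cast (by lia : a α ≤ -1)
    have := (abs_lt.1 (hM α)).2
    nlinarith
  refine ⟨(M : ℂ) • x + δ, fun α hα => ?_, fun α h => ?_⟩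
  · rcases lt_trichotomy (a α) 0 with h | h | h
    · exact (p1 α h).ne
    · rw [e, h]; simpa using hδ α hα
    · rw [e]
      have h1 : (1 : ℝ) ≤ a α := by exact_mod_cast h
      have := (abs_lt.1 (hM α)).1
      nlinarith
  · by_contra! hc
    exact absurd (p1 α hc) (by linarith)

lemma exists_strongly_orth {n : ℕ} (hh ee ff : Fin n → L)
    (ht : ∀ i, IsSl2Triple (hh i) (ee i) (ff i))
    (hhe : ∀ i j, i ≠ j → ⁅hh i, ee j⁆ = 0) (hhf : ∀ i j, i ≠ j → ⁅hh i, ff j⁆ = 0)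
    (hH : ∀ i, hh i ∈ H) (hli : LinearIndependent ℂ hh) :
    ∃ B : Finset (Weight ℂ H L), n ≤ B.card ∧ (∀ b ∈ B, b.IsNonZero) ∧
      (∀ β ∈ B, ∀ β' ∈ B, β ≠ β' → β (coroot β') = 0) ∧
      (∀ β ∈ B, ∀ β' ∈ B, β ≠ β' → ∀ γ : Weight ℂ H L, ¬ ∀ x, γ x = β x + β' x) := by
  classical
  haveI : Fintype (Weight ℂ H L) := Fintype.ofFinite _
  let hv : Fin n → H := fun i => ⟨hh i, hH i⟩
  obtain ⟨N, hN⟩ := generic_vec hv (Set.range fun B : Finset (Weight ℂ H L) =>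
    Submodule.span ℂ (coroot '' (B : Set (Weight ℂ H L)))) (Set.finite_range _)
  have hint (α : Weight ℂ H L) (i : Fin n) : ∃ z : ℤ, α (hv i) = z := by
    obtain ⟨v, hv1, hv0⟩ := α.exists_ne_zero
    have := lie_eq_smul_of_mem_rootSpace hv1 (hv i)
    exact sl2_int (ht i) this hv0
  choose z hz using hint
  set x : H := ∑ i : Fin n, (N : ℂ) ^ (i : ℕ) • hv i with hxdef
  have ha (α : Weight ℂ H L) : α x = ((∑ i : Fin n, (N : ℤ) ^ (i : ℕ) * z α i : ℤ) : ℂ) := by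
    have : α x = Weight.toLinear ℂ H L α x := rfl
    rw [this, hxdef, map_sum]
    push_cast
    refine Finset.sum_congr rfl fun i _ => ?_
    rw [map_smul, smul_eq_mul, Weight.toLinear_apply, hz]
  obtain ⟨δ, hδ, hpos⟩ := rt_orth_span _ x ha
  let Ψ : Finset (Weight ℂ H L) := Finset.univ.filter fun α => α.IsNonZero
  have hΨr : ∀ α ∈ Ψ, ∀ β ∈ Ψ, reflectRoot β α ∈ Ψ := by
    intro α hα β _
    simp only [Ψ, Finset.mem_filter, Finset.mem_univ, true_and] at hα ⊢
    exact reflectRoot_isNonZero _ _ hα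
  obtain ⟨B, hBΨ, -, hBo, hBs, hBw⟩ := rt_cascade δ hδ Ψ.card Ψ le_rfl
    (fun α h => by simpa [Ψ] using h) hΨr (fun α _ β _ γ hγ _ => by simpa [Ψ] using hγ)
  have hBn : ∀ b ∈ B, b.IsNonZero := fun b hb => by simpa [Ψ] using hBΨ hb
  have hxm := hw_mem_span hh ee ff ht hhe hhf hH (fun i => (N : ℂ) ^ (i : ℕ)) δ x
    (by simp [hxdef, hv]) hδ _ ha hpos B hBn hBo (by
      intro α hα γ hγ
      have hα0 : α ∈ Ψ := by
        simp only [Ψ, Finset.mem_filter, Finset.mem_univ, true_and]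
        intro h0
        rw [Weight.IsZero] at h0
        rw [h0] at hα
        simp at hα
      obtain ⟨γ', h1, h2⟩ := rt_refl_set Ψ hΨr B hBΨ hBo α hα0
      have : γ = γ' := by
        apply Weight.ext
        intro y; rw [hγ, h2]
      exact hBw α hα0 hα γ (this ▸ h1) hγ)
  have hall := hN _ ⟨B, rfl⟩ hxm
  refine ⟨B, ?_, hBn, hBo, hBs⟩
  have hli' : LinearIndependent ℂ hv := LinearIndependent.of_comp H.subtype hli
  have h1 := finrank_span_eq_card hli'
  have h2 : Submodule.span ℂ (Set.range hv) ≤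
      Submodule.span ℂ (coroot '' (B : Set (Weight ℂ H L))) := by
    rw [Submodule.span_le]; rintro _ ⟨i, rfl⟩; exact hall i
  have h3 := Submodule.finrank_mono h2
  have h4 := finrank_span_finset_le_card (R := ℂ) (B.image (coroot (K := ℂ) (H := H) (L := L)))
  rw [Finset.coe_image, Set.finrank] at h4
  rw [h1, Fintype.card_fin] at h3
  exact h3.trans (h4.trans Finset.card_image_le)

end Gen
section Emb
open LieModule LieAlgebra LieAlgebra.IsKilling

section one
variable {L : Type*} [LieRing L] [LieAlgebra ℂ L]

lemma sl_mem_iff (A : Matrix (Fin 2) (Fin 2) ℂ) : A ∈ SpecialLinear.sl (Fin 2) ℂ ↔ A.trace = 0 :=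
  LinearMap.mem_ker

lemma sl_trace_zero (A : SpecialLinear.sl (Fin 2) ℂ) : A.1 1 1 = - A.1 0 0 := by
  have h := sl_mem_iff A.1 |>.1 A.2
  rw [Matrix.trace_fin_two] at h
  linear_combination h

noncomputable def slHom {h e f : L} (t : IsSl2Triple h e f) :
    SpecialLinear.sl (Fin 2) ℂ →ₗ⁅ℂ⁆ L where
  toFun A := A.1 0 0 • h + A.1 0 1 • e + A.1 1 0 • f
  map_add' A B := by simp; module
  map_smul' c A := by simp; module
  map_lie' := by
    intro A B
    have h1 : ⁅h, e⁆ = (2 : ℂ) • e := t.lie_h_e_smul ℂ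
    have h2 : ⁅h, f⁆ = -((2 : ℂ) • f) := by
      rw [t.lie_h_f_nsmul, two_smul, two_smul]
    have h3 : ⁅e, f⁆ = h := t.lie_e_f
    have h4 : ⁅e, h⁆ = -((2 : ℂ) • e) := by rw [← lie_skew, h1]
    have h5 : ⁅f, h⁆ = (2 : ℂ) • f := by rw [← lie_skew, h2, neg_neg]
    have h6 : ⁅f, e⁆ = -h := by rw [← lie_skew, h3]
    have hb : (⁅A, B⁆ : SpecialLinear.sl (Fin 2) ℂ).1 = A.1 * B.1 - B.1 * A.1 := rfl
    simp only [hb, Matrix.sub_apply, Matrix.mul_apply, Fin.sum_univ_two, sl_trace_zero,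
      add_lie, lie_add, smul_lie, lie_smul, h1, h2, h3, h4, h5, h6, lie_self]
    module

lemma slHom_apply {h e f : L} (t : IsSl2Triple h e f) (A : SpecialLinear.sl (Fin 2) ℂ) :
    slHom t A = A.1 0 0 • h + A.1 0 1 • e + A.1 1 0 • f := rfl

lemma slHom_inj {h e f : L} (t : IsSl2Triple h e f) : Function.Injective (slHom t) := by
  rw [injective_iff_map_eq_zero]
  intro A hA
  have h1 : ⁅h, e⁆ = (2 : ℂ) • e := t.lie_h_e_smul ℂ
  have h3 : ⁅e, f⁆ = h := t.lie_e_f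
  have h4 : ⁅e, h⁆ = -((2 : ℂ) • e) := by rw [← lie_skew, h1]
  have he := t.e_ne_zero
  rw [slHom_apply] at hA
  have k1 := congrArg (fun y => ⁅e, ⁅e, y⁆⁆) hA
  simp only [lie_add, lie_smul, h4, h3, lie_self, lie_neg, lie_zero, smul_zero, neg_zero, zero_add, add_zero] at k1
  have hc : A.1 1 0 = 0 := by simpa [he] using k1
  have k2 := congrArg (fun y => ⁅e, y⁆) hA
  simp only [lie_add, lie_smul, h4, h3, lie_self, lie_zero, smul_zero, hc, zero_smul, add_zero] at k2
  have ha : A.1 0 0 = 0 := by simpa [he] using k2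
  have hb : A.1 0 1 = 0 := by simpa [he, ha, hc] using hA
  apply Subtype.ext
  ext i j
  fin_cases i <;> fin_cases j <;> simp [ha, hb, hc, sl_trace_zero]

end one

def slE : SpecialLinear.sl (Fin 2) ℂ := ⟨!![0, 1; 0, 0], by
  rw [sl_mem_iff]; simp [Matrix.trace_fin_two]⟩
def slF : SpecialLinear.sl (Fin 2) ℂ := ⟨!![0, 0; 1, 0], by
  rw [sl_mem_iff]; simp [Matrix.trace_fin_two]⟩
def slH : SpecialLinear.sl (Fin 2) ℂ := ⟨!![1, 0; 0, -1], by
  rw [sl_mem_iff]; simp [Matrix.trace_fin_two]⟩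

lemma sl_bracket' (A B : SpecialLinear.sl (Fin 2) ℂ) :
    (⁅A, B⁆ : SpecialLinear.sl (Fin 2) ℂ).1 = A.1 * B.1 - B.1 * A.1 := rfl

lemma slTriple : IsSl2Triple slH slE slF where
  h_ne_zero := by
    intro h
    have := congrArg (fun A => A.1 0 0) h
    simp [slH] at this
  lie_e_f := by
    apply Subtype.ext; rw [sl_bracket']
    ext i j; fin_cases i <;> fin_cases j <;> simp [slE, slF, slH]
  lie_h_e_nsmul := by
    apply Subtype.ext; rw [sl_bracket']
    ext i j; fin_cases i <;> fin_cases j <;> simp [slE, slF, slH]; norm_num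
  lie_h_f_nsmul := by
    apply Subtype.ext; rw [sl_bracket']
    ext i j; fin_cases i <;> fin_cases j <;> simp [slE, slF, slH]; norm_num

lemma sl_center (A : SpecialLinear.sl (Fin 2) ℂ) (h : ∀ B : SpecialLinear.sl (Fin 2) ℂ, ⁅A, B⁆ = 0) : A = 0 := by
  have h1 := congrArg (fun A => A.1 0 1) (h slH)
  have h2 := congrArg (fun A => A.1 1 0) (h slH)
  have h3 := congrArg (fun A => A.1 0 1) (h slE)
  simp only [sl_bracket', Matrix.sub_apply, Matrix.mul_apply, Fin.sum_univ_two,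
    sl_trace_zero] at h1 h2 h3
  simp [slE, slH, sl_trace_zero] at h1 h2 h3
  have a1 : A.1 0 1 = 0 := by linear_combination (-1/2) * h1
  have a2 : A.1 1 0 = 0 := h2
  have a3 : A.1 0 0 = 0 := h3
  apply Subtype.ext
  ext i j
  fin_cases i <;> fin_cases j <;> simp [a1, a2, a3, sl_trace_zero]

variable {L : Type*} [LieRing L] [LieAlgebra ℂ L] [FiniteDimensional ℂ L] [IsKilling ℂ L]
  {H : LieSubalgebra ℂ L} [H.IsCartanSubalgebra]

lemma rt_lie_zero {χ ψ : H → ℂ} {u v : L} (hu : u ∈ rootSpace H χ) (hv : v ∈ rootSpace H ψ)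
    (h : ∀ γ : Weight ℂ H L, ¬ ∀ x, γ x = χ x + ψ x) : ⁅u, v⁆ = 0 := by
  have h1 := lie_mem_genWeightSpace_of_mem_genWeightSpace hu hv
  by_contra h0
  refine h ⟨χ + ψ, fun hb => h0 ?_⟩ fun x => rfl
  rw [hb] at h1
  simpa using h1

lemma rt_so_sub {b b' : Weight ℂ H L} (hb' : b'.IsNonZero) (ho : b (coroot b') = 0)
    (hs : ∀ γ : Weight ℂ H L, ¬ ∀ x, γ x = b x + b' x) (γ : Weight ℂ H L) :
    ¬ ∀ x, γ x = b x - b' x := by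
  intro h
  refine hs (reflectRoot b' γ) fun x => ?_
  rw [rt_refl_apply, h, h, ho, root_apply_coroot hb']
  ring

lemma slHom_cross {b b' : Weight ℂ H L} (hb : b.IsNonZero) (hb' : b'.IsNonZero)
    (ho : b (coroot b') = 0)
    (hs : ∀ γ : Weight ℂ H L, ¬ ∀ x, γ x = b x + b' x)
    {e f e' f' : L} (t : IsSl2Triple (coroot b : L) e f) (t' : IsSl2Triple (coroot b' : L) e' f')
    (he : e ∈ rootSpace H b) (hf : f ∈ rootSpace H (-b))
    (he' : e' ∈ rootSpace H b') (hf' : f' ∈ rootSpace H (-b')) (A A' : SpecialLinear.sl (Fin 2) ℂ) :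
    ⁅slHom t A, slHom t' A'⁆ = 0 := by
  have ho' := rt_orth_symm hb hb' ho
  have hd := rt_so_sub hb' ho hs
  have c1 : ⁅e, e'⁆ = 0 := rt_lie_zero he he' hs
  have c2 : ⁅e, f'⁆ = 0 := rt_lie_zero he hf' fun γ h => hd γ fun x => by
    rw [h]; simp [sub_eq_add_neg]
  have c3 : ⁅f, e'⁆ = 0 := rt_lie_zero hf he' fun γ h => hd (-γ) fun x => by
    rw [Weight.coe_neg, Pi.neg_apply, h]; simp; ring
  have c4 : ⁅f, f'⁆ = 0 := rt_lie_zero hf hf' fun γ h => hs (-γ) fun x => by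
    rw [Weight.coe_neg, Pi.neg_apply, h]; simp; ring
  have d1 : ⁅(coroot b : L), e'⁆ = 0 := by
    have := lie_eq_smul_of_mem_rootSpace he' (coroot b)
    rw [ho', zero_smul] at this; exact this
  have d2 : ⁅(coroot b : L), f'⁆ = 0 := by
    have := lie_eq_smul_of_mem_rootSpace hf' (coroot b)
    rw [Pi.neg_apply, ho', neg_zero, zero_smul] at this; exact this
  have d3 : ⁅e, (coroot b' : L)⁆ = 0 := by
    have := lie_eq_smul_of_mem_rootSpace he (coroot b')
    rw [ho, zero_smul] at this
    rw [← lie_skew, neg_eq_zero]; exact this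
  have d4 : ⁅f, (coroot b' : L)⁆ = 0 := by
    have := lie_eq_smul_of_mem_rootSpace hf (coroot b')
    rw [Pi.neg_apply, ho, neg_zero, zero_smul] at this
    rw [← lie_skew, neg_eq_zero]; exact this
  have d5 : ⁅(coroot b : L), (coroot b' : L)⁆ = 0 := by
    have := trivial_lie_zero H H (coroot b) (coroot b')
    exact congrArg Subtype.val this
  simp only [slHom_apply, add_lie, lie_add, smul_lie, lie_smul, c1, c2, c3, c4, d1, d2, d3, d4, d5,
    smul_zero, add_zero]

lemma mem_simRootSpace' {χ : H → ℂ} {u : L} (hu : u ∈ rootSpace H χ) (α : H →ₗ[ℂ] ℂ)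
    (hα : ∀ x, α x = χ x) : u ∈ simRootSpace H α := by
  intro h
  rw [hα]
  exact lie_eq_smul_of_mem_rootSpace hu h

lemma exists_regular_emb {n : ℕ} (b : Fin n → Weight ℂ H L) (hb : ∀ i, (b i).IsNonZero)
    (ho : ∀ i j, i ≠ j → b i (coroot (b j)) = 0)
    (hs : ∀ i j, i ≠ j → ∀ γ : Weight ℂ H L, ¬ ∀ x, γ x = b i x + b j x) :
    ∃ f : (⨁ _ : Fin n, SpecialLinear.sl (Fin 2) ℂ) →ₗ⁅ℂ⁆ L,
      Function.Injective f ∧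
        f.range.toSubmodule = (H.toSubmodule ⊓ f.range.toSubmodule) ⊔
          ⨆ α ∈ {α : H →ₗ[ℂ] ℂ | α ≠ 0 ∧ simRootSpace H α ≠ ⊥},
            (simRootSpace H α ⊓ f.range.toSubmodule) := by
  have ex (i : Fin n) : ∃ e f : L, IsSl2Triple (coroot (b i) : L) e f ∧ e ∈ rootSpace H (b i) ∧
      f ∈ rootSpace H (-(b i)) := by
    obtain ⟨h, e, f, t, he, hf⟩ := exists_isSl2Triple_of_weight_isNonZero (hb i)
    have := t.h_eq_coroot (hb i) he hf
    subst this
    exact ⟨e, f, t, he, hf⟩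
  choose e f t he hf using ex
  have hcross : Pairwise fun i j => ∀ (x y : SpecialLinear.sl (Fin 2) ℂ),
      ⁅slHom (t i) x, slHom (t j) y⁆ = 0 := fun i j hij x y =>
    slHom_cross (hb i) (hb j) (ho i j hij) (hs i j hij) (t i) (t j) (he i) (hf i) (he j) (hf j) x y
  let F : (⨁ _ : Fin n, SpecialLinear.sl (Fin 2) ℂ) →ₗ⁅ℂ⁆ L :=
    DirectSum.toLieAlgebra L (fun i => slHom (t i)) hcross
  have hF (i : Fin n) (y : SpecialLinear.sl (Fin 2) ℂ) :
      F (DirectSum.of (fun _ : Fin n => SpecialLinear.sl (Fin 2) ℂ) i y) = slHom (t i) y :=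
    DirectSum.toModule_lof ℂ (M := fun _ : Fin n => SpecialLinear.sl (Fin 2) ℂ)
      (φ := fun i => (slHom (t i) : SpecialLinear.sl (Fin 2) ℂ →ₗ[ℂ] L)) i y
  refine ⟨F, ?_, ?_⟩
  · rw [injective_iff_map_eq_zero]
    intro x hx
    refine DFinsupp.ext fun i => ?_
    refine sl_center _ fun y => slHom_inj (t i) ?_
    rw [map_zero, ← hF]
    have h1 : DirectSum.of (fun _ : Fin n => SpecialLinear.sl (Fin 2) ℂ) i ⁅x i, y⁆ =
        ⁅x, DirectSum.of (fun _ : Fin n => SpecialLinear.sl (Fin 2) ℂ) i y⁆ := by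
      refine DFinsupp.ext fun j => ?_
      erw [DirectSum.bracket_apply]
      by_cases hij : j = i
      · subst hij
        simp [DirectSum.of_eq_same]
      · rw [DirectSum.of_eq_of_ne _ _ _ hij, DirectSum.of_eq_of_ne _ _ _ hij, lie_zero]
    erw [h1]
    rw [LieHom.map_lie, hx, zero_lie]
  · apply le_antisymm
    · rintro _ ⟨x, rfl⟩
      induction x using DirectSum.induction_on with
      | zero => erw [map_zero]; exact Submodule.zero_mem _
      | add x y hx hy => erw [map_add]; exact Submodule.add_mem _ hx hy
      | of i y =>
        have m1 : (coroot (b i) : L) ∈ F.range := ⟨_, (hF i slH).trans (by rw [slHom_apply]; simp [slH])⟩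
        have m2 : e i ∈ F.range := ⟨_, (hF i slE).trans (by rw [slHom_apply]; simp [slE])⟩
        have m3 : f i ∈ F.range := ⟨_, (hF i slF).trans (by rw [slHom_apply]; simp [slF])⟩
        have hne : Weight.toLinear ℂ H L (b i) ≠ 0 := fun h => hb i (by
          funext x; exact LinearMap.congr_fun h x)
        have s1 : e i ∈ simRootSpace H (Weight.toLinear ℂ H L (b i)) :=
          mem_simRootSpace' (he i) _ fun x => rfl
        have s2 : f i ∈ simRootSpace H (-Weight.toLinear ℂ H L (b i)) :=
          mem_simRootSpace' (hf i) _ fun x => rfl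
        erw [hF i y, slHom_apply]
        refine Submodule.add_mem _ (Submodule.add_mem _ ?_ ?_) ?_
        · exact Submodule.smul_mem _ _ (Submodule.mem_sup_left ⟨(coroot (b i)).2, m1⟩)
        · refine Submodule.smul_mem _ _ (Submodule.mem_sup_right ?_)
          refine Submodule.mem_iSup_of_mem (Weight.toLinear ℂ H L (b i)) ?_
          refine Submodule.mem_iSup_of_mem ⟨hne, fun h => ?_⟩ ⟨s1, m2⟩
          rw [h] at s1
          exact (t i).e_ne_zero (by simpa using s1)
        · refine Submodule.smul_mem _ _ (Submodule.mem_sup_right ?_)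
          refine Submodule.mem_iSup_of_mem (-Weight.toLinear ℂ H L (b i)) ?_
          refine Submodule.mem_iSup_of_mem ⟨neg_ne_zero.2 hne, fun h => ?_⟩ ⟨s2, m3⟩
          rw [h] at s2
          exact (t i).f_ne_zero (by simpa using s2)
    · exact sup_le inf_le_right (iSup₂_le fun _ _ => inf_le_right)

end Emb

theorem sl2_power_embeds_regularly
    {L : Type*} [LieRing L] [LieAlgebra ℂ L] [FiniteDimensional ℂ L]
    [LieAlgebra.IsSemisimple ℂ L] (n : ℕ)
    (h : ∃ f : (⨁ _ : Fin n, LieAlgebra.SpecialLinear.sl (Fin 2) ℂ) →ₗ⁅ℂ⁆ L,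
      Function.Injective f) :
    ∃ f : (⨁ _ : Fin n, LieAlgebra.SpecialLinear.sl (Fin 2) ℂ) →ₗ⁅ℂ⁆ L,
      Function.Injective f ∧
      ∃ H : LieSubalgebra ℂ L, H.IsCartanSubalgebra ∧
        f.range.toSubmodule = (H.toSubmodule ⊓ f.range.toSubmodule) ⊔
          ⨆ α ∈ {α : H →ₗ[ℂ] ℂ | α ≠ 0 ∧ simRootSpace H α ≠ ⊥},
            (simRootSpace H α ⊓ f.range.toSubmodule) := by
  obtain ⟨f, hf⟩ := h
  have : LieAlgebra.IsKilling ℂ L := inferInstance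
  let φ (i : Fin n) : LieAlgebra.SpecialLinear.sl (Fin 2) ℂ →ₗ⁅ℂ⁆ L :=
    f.comp (DirectSum.lieAlgebraOf ℂ (Fin n) (fun _ => LieAlgebra.SpecialLinear.sl (Fin 2) ℂ) i)
  have hφ (i : Fin n) (y) : φ i y =
    f (DirectSum.of (fun _ : Fin n => LieAlgebra.SpecialLinear.sl (Fin 2) ℂ) i y) := rfl
  have hφi (i) : Function.Injective (φ i) := by
    intro x y hxy
    exact DirectSum.of_injective i (hf hxy)
  have hc (i j : Fin n) (hij : i ≠ j) (x y) : ⁅φ i x, φ j y⁆ = 0 := by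
    rw [hφ, hφ, ← LieHom.map_lie]
    erw [DirectSum.lie_of_of_ne _ hij]
    exact map_zero f
  have ht (i) : IsSl2Triple (φ i slH) (φ i slE) (φ i slF) :=
    { h_ne_zero := fun h => slTriple.h_ne_zero (hφi i (by rw [h, map_zero]))
      lie_e_f := by rw [← LieHom.map_lie, slTriple.lie_e_f]
      lie_h_e_nsmul := by rw [← LieHom.map_lie, slTriple.lie_h_e_nsmul, map_nsmul]
      lie_h_f_nsmul := by rw [← LieHom.map_lie, slTriple.lie_h_f_nsmul, map_neg, map_nsmul] }
  obtain ⟨H, hH, hm⟩ := exists_cartan_of_family (fun i => φ i slH) (fun i j => by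
      by_cases hij : i = j
      · subst hij; exact lie_self _
      · exact hc i j hij _ _) (fun i x hx => sl2_ker_sq (ht i) hx)
  have hli : LinearIndependent ℂ (fun i => φ i slH) := by
    rw [Fintype.linearIndependent_iff]
    intro g hg i
    have h1 := congrArg (fun z => ⁅z, φ i slE⁆) hg
    simp only [zero_lie, sum_lie, smul_lie] at h1
    rw [Finset.sum_eq_single i] at h1
    · rw [(ht i).lie_h_e_smul ℂ] at h1
      simpa [(ht i).e_ne_zero] using h1
    · intro j _ hj; rw [hc j i hj, smul_zero]
    · simp
  obtain ⟨B, hcard, hBn, hBo, hBs⟩ := exists_strongly_orth (H := H) _ _ _ ht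
    (fun i j hij => hc i j hij _ _) (fun i j hij => hc i j hij _ _) hm hli
  let emb : Fin n → LieModule.Weight ℂ H L := fun i => (B.equivFin.symm (Fin.castLE hcard i)).1
  have hemb (i) : emb i ∈ B := (B.equivFin.symm (Fin.castLE hcard i)).2
  have hinj (i j) (hij : i ≠ j) : emb i ≠ emb j := fun h => hij
    (Fin.castLE_injective hcard (B.equivFin.symm.injective (Subtype.ext h)))
  obtain ⟨F, h1, h2⟩ := exists_regular_emb emb (fun i => hBn _ (hemb i))
    (fun i j hij => hBo _ (hemb i) _ (hemb j) (hinj i j hij))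
    (fun i j hij => hBs _ (hemb i) _ (hemb j) (hinj i j hij))
  exact ⟨F, h1, H, hH, h2⟩
end
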